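/- Assume Σ_{m ≤ M, q | m} m^α K_m(a) ≪ M^{α+1/2}(Mq^{-2})^γ (Mq)^{o(1)} for all α ≥ −1/2 and all q ≥ 1 (Corollary on Kloosterman averages in progressions), with 0 < γ ≤ 1/2. Then for any fixed integer a and any fixed k ≥ 2, Σ_{m=1}^{M} K_m(a) κ_k(m) ≪ M^{1/2+γ+o(1)} + M^{1/2+1/(2k)+o(1)}, where κ_k is the indicator function of k-th-power-free integers. -/

import Mathlib

open Finset

noncomputable def Kl (m : ℕ) (a : ℤ) : ℂ :=
  (1 / Real.sqrt m) * ∑ x ∈ (Finset.range m).filter (fun x => Nat.Coprime x m),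
    Complex.exp (2 * Real.pi * Complex.I *
      (((a * (x : ℤ) + ((((x : ZMod m)⁻¹ : ZMod m)).val : ℤ) : ℤ) : ℂ) / (m : ℂ)))

open Classical in
/-- The indicator function of `k`-th-power-free integers. -/
noncomputable def kappa (k m : ℕ) : ℝ :=
  if ∀ p : ℕ, p.Prime → ¬ p ^ k ∣ m then 1 else 0

section Stepanov

open Polynomial

theorem eq_zero_of_squarefree_mul_sq_eq {F : Type*} [Field F] {D : F[X]} (hD : Squarefree D)
    (hdeg : 0 < D.natDegree) {c : F} (hc : c ≠ 0) {A B : F[X]} (h : D * A ^ 2 = C c * B ^ 2) :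
    A = 0 ∧ B = 0 := by
  have hC : C c ≠ 0 := by simpa using hc
  by_cases hA : A = 0
  · subst hA
    have : C c * B ^ 2 = 0 := by rw [← h]; ring
    exact ⟨rfl, by simpa [hc] using this⟩
  exfalso
  have h1 : A ^ 2 ∣ B ^ 2 := by
    have h2 : A ^ 2 ∣ C c * B ^ 2 := ⟨D, by rw [← h]; ring⟩
    have h3 : B ^ 2 = C c⁻¹ * (C c * B ^ 2) := by
      rw [← mul_assoc, ← C_mul, inv_mul_cancel₀ hc, C_1, one_mul]
    rw [h3]
    exact h2.mul_left _
  obtain ⟨Q, rfl⟩ := (IsIntegrallyClosed.pow_dvd_pow_iff two_ne_zero).1 h1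
  have h4 : D = C c * Q ^ 2 := by
    have : A ^ 2 ≠ 0 := pow_ne_zero _ hA
    apply mul_right_cancel₀ this
    rw [h]; ring
  have h5 : IsUnit Q := hD Q ⟨C c, by rw [h4]; ring⟩
  have h6 : D.natDegree = 0 := by
    rw [h4]
    exact natDegree_eq_zero_of_isUnit
      (((Polynomial.isUnit_C).2 (isUnit_iff_ne_zero.2 hc)).mul (h5.pow 2))
  omega

theorem pow_char_pow_eq_add_X_pow {F : Type*} [Field F] (p : ℕ) [Fact p.Prime] [CharP F p] (r : ℕ)
    (D : F[X]) : D ^ p ^ r = C (D.coeff 0 ^ p ^ r) + X ^ p ^ r * D.divX ^ p ^ r := by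
  conv_lhs => rw [← divX_mul_X_add D]
  rw [add_pow_char_pow, mul_pow, C_pow]
  ring

/-- The nonvanishing step of Stepanov's method: an auxiliary polynomial built from low-degree
coefficients is zero only if all of its coefficients are. -/
theorem eq_zero_of_mul_sq_eq_pow_char {F : Type*} [Field F] {p : ℕ} [Fact p.Prime] [CharP F p]
    {r : ℕ} {D : F[X]} (hD : Squarefree D) (hdeg : 0 < D.natDegree) (h0 : D.coeff 0 ≠ 0) {L : ℕ}
    (hL : 2 * L + D.natDegree < p ^ r) {K : ℕ} (A B : Fin K → F[X])
    (hA : ∀ k, (A k).natDegree ≤ L) (hB : ∀ k, (B k).natDegree ≤ L)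
    (h : D * (∑ k : Fin K, X ^ (p ^ r * (k : ℕ)) * A k) ^ 2 =
      D ^ p ^ r * (∑ k : Fin K, X ^ (p ^ r * (k : ℕ)) * B k) ^ 2) :
    A = 0 ∧ B = 0 := by
  induction K with
  | zero => exact ⟨Subsingleton.elim _ _, Subsingleton.elim _ _⟩
  | succ K ih =>
    set q := p ^ r
    have split : ∀ A : Fin (K + 1) → F[X], ∑ k : Fin (K + 1), X ^ (q * (k : ℕ)) * A k =
        A 0 + X ^ q * ∑ k : Fin K, X ^ (q * (k : ℕ)) * A k.succ := by
      intro A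
      rw [Fin.sum_univ_succ, Finset.mul_sum]
      simp [mul_add, pow_add, mul_comm, mul_left_comm]
    set A' := ∑ k : Fin K, X ^ (q * (k : ℕ)) * A k.succ with hA'
    set B' := ∑ k : Fin K, X ^ (q * (k : ℕ)) * B k.succ with hB'
    have hq := pow_char_pow_eq_add_X_pow p r D
    rw [split A, split B] at h
    have h1 : X ^ q ∣ D * A 0 ^ 2 - C (D.coeff 0 ^ q) * B 0 ^ 2 := by
      refine ⟨D.divX ^ q * (B 0 + X ^ q * B') ^ 2 + C (D.coeff 0 ^ q) * (2 * B 0 * B' +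
        X ^ q * B' ^ 2) - D * (2 * A 0 * A' + X ^ q * A' ^ 2), ?_⟩
      rw [hq] at h
      linear_combination h
    have h2 : D * A 0 ^ 2 - C (D.coeff 0 ^ q) * B 0 ^ 2 = 0 := by
      by_contra hne
      have h3 := natDegree_le_of_dvd h1 hne
      rw [natDegree_X_pow] at h3
      have h4 : (D * A 0 ^ 2 - C (D.coeff 0 ^ q) * B 0 ^ 2).natDegree ≤ 2 * L + D.natDegree := by
        refine (natDegree_sub_le _ _).trans (max_le ?_ ?_)
        · refine natDegree_mul_le.trans ?_
          have := natDegree_pow_le (p := A 0) (n := 2)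
          have := hA 0
          omega
        · refine (natDegree_C_mul_le _ _).trans ?_
          have := natDegree_pow_le (p := B 0) (n := 2)
          have := hB 0
          omega
      omega
    obtain ⟨hA0, hB0⟩ := eq_zero_of_squarefree_mul_sq_eq hD hdeg (pow_ne_zero q h0)
      (sub_eq_zero.1 h2)
    have h5 : D * A' ^ 2 = D ^ q * B' ^ 2 := by
      have hX : (X ^ q : F[X]) ^ 2 ≠ 0 := pow_ne_zero _ (pow_ne_zero _ X_ne_zero)
      apply mul_left_cancel₀ hX
      rw [hA0, hB0] at h
      linear_combination h
    obtain ⟨ha, hb⟩ := ih (fun k => A k.succ) (fun k => B k.succ) (fun k => hA _) (fun k => hB _) h5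
    constructor
    · funext k
      refine Fin.cases hA0 (fun k => congrFun ha k) k
    · funext k
      refine Fin.cases hB0 (fun k => congrFun hb k) k

/-- Stepanov's bound for the number of points at which `D` has a prescribed quadratic character,
over a field whose order is a square. -/
theorem card_filter_eval_pow_eq_le {F : Type*} [Field F] [Fintype F] [DecidableEq F] {p : ℕ}
    [Fact p.Prime] [CharP F p] {r h n : ℕ} (hq : p ^ r = 2 * h + 1)
    (hF : Fintype.card F = (p ^ r) ^ 2) {D : F[X]} (hD : Squarefree D) (hdeg : 0 < D.natDegree)
    (hn : D.natDegree ≤ 2 * n) (h0 : D.coeff 0 ≠ 0) (hnh : 2 * n ≤ h) {ε : F} (hε : ε ≠ 0) :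
    #{y : F | D.eval y ^ (h * (p ^ r + 1)) = ε} ≤ p ^ r * (h + 3 * n) := by
  set q := p ^ r with hqdef
  obtain ⟨L, rfl⟩ : ∃ L, h = n + L := ⟨h - n, by omega⟩
  set h := n + L with hh
  set E : F[X] := D ^ h with hE
  have hEdeg : E.natDegree ≤ 2 * n * h := by
    refine natDegree_pow_le.trans ?_
    rw [mul_comm]
    gcongr
  let ι := Fin (h + 2 * n) × Fin (L + 1)
  let N := h + 2 * n + q * L + 2 * n * h
  let w : ι ⊕ ι → F[X] := Sum.elim (fun i => X ^ ((i.1 : ℕ) + q * i.2) * E)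
    (fun i => C ε * X ^ ((i.1 : ℕ) + q * i.2))
  have hexp : ∀ i : ι, (i.1 : ℕ) + q * i.2 + 2 * n * h < N := by
    intro i
    have h1 := i.1.2
    have h2 : q * (i.2 : ℕ) ≤ q * L := Nat.mul_le_mul_left _ (Nat.lt_succ_iff.1 i.2.2)
    simp only [N]
    omega
  have hwdeg : ∀ j, (w j).natDegree < N := by
    rintro (i | i)
    · refine lt_of_le_of_lt ?_ (hexp i)
      refine natDegree_mul_le.trans ?_
      rw [natDegree_X_pow]
      gcongr
    · refine lt_of_le_of_lt ?_ (hexp i)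
      refine (natDegree_C_mul_le _ _).trans ?_
      rw [natDegree_X_pow]
      omega
  let Φ : (ι ⊕ ι → F) →ₗ[F] (Fin N → F) :=
    (LinearMap.pi fun i : Fin N => lcoeff F (i : ℕ)) ∘ₗ Fintype.linearCombination F w
  have hker : LinearMap.ker Φ ≠ ⊥ := by
    apply LinearMap.ker_ne_bot_of_finrank_lt
    rw [Module.finrank_fintype_fun_eq_card, Module.finrank_fintype_fun_eq_card, Fintype.card_fin,
      Fintype.card_sum, Fintype.card_prod, Fintype.card_fin, Fintype.card_fin]
    simp only [N, hq]
    have : n ≤ L := by omega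
    have h1 : 0 < n := by omega
    nlinarith
  obtain ⟨v, hv, hv0⟩ := (Submodule.ne_bot_iff _).1 hker
  have hP : ∑ j, v j • w j = 0 := by
    ext m
    rw [coeff_zero]
    by_cases hm : m < N
    · exact congrFun (LinearMap.mem_ker.1 hv) ⟨m, hm⟩
    · apply coeff_eq_zero_of_natDegree_lt
      refine lt_of_lt_of_le ?_ (not_lt.1 hm)
      have hN : 0 < N := by simp only [N]; omega
      refine lt_of_le_of_lt (natDegree_sum_le_of_forall_le (n := N - 1) _ _ fun j _ => ?_)
        (Nat.sub_lt hN one_pos)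
      exact (natDegree_smul_le _ _).trans (Nat.le_sub_one_of_lt (hwdeg j))
  let A : Fin (h + 2 * n) → F[X] := fun k =>
    ∑ l : Fin (L + 1), C (v (Sum.inl (k, l)) ^ q) * X ^ (l : ℕ)
  let B : Fin (h + 2 * n) → F[X] := fun k =>
    ∑ l : Fin (L + 1), C (v (Sum.inr (k, l)) ^ q) * X ^ (l : ℕ)
  have hdegsum : ∀ c : Fin (L + 1) → F, (∑ l, C (c l) * X ^ (l : ℕ)).natDegree ≤ L := by
    intro c
    refine natDegree_sum_le_of_forall_le _ _ fun l _ => ?_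
    exact (natDegree_C_mul_X_pow_le _ _).trans (Nat.lt_succ_iff.1 l.2)
  have hcoeff : ∀ (c : Fin (L + 1) → F), ∑ l, C (c l) * X ^ (l : ℕ) = 0 → c = 0 := by
    intro c hc
    funext l
    have := congrArg (fun P => coeff P (l : ℕ)) hc
    simpa [finsetSum_coeff, coeff_C_mul, coeff_X_pow, Fin.val_inj] using this
  let H : F[X] := ∑ k : Fin (h + 2 * n), X ^ (q * (k : ℕ)) * A k +
    E * ∑ k : Fin (h + 2 * n), X ^ (q * (k : ℕ)) * B k
  have hH0 : H ≠ 0 := by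
    intro hH
    have h1 : D * (∑ k : Fin (h + 2 * n), X ^ (q * (k : ℕ)) * A k) ^ 2 =
        D ^ q * (∑ k : Fin (h + 2 * n), X ^ (q * (k : ℕ)) * B k) ^ 2 := by
      rw [eq_neg_of_add_eq_zero_left hH, hq, hE]
      ring
    obtain ⟨hA, hB⟩ := eq_zero_of_mul_sq_eq_pow_char hD hdeg h0 (L := L) (by rw [← hqdef]; omega)
      A B (fun k => hdegsum _) (fun k => hdegsum _) h1
    apply hv0
    have hq0 : q ≠ 0 := by omega
    funext j
    rcases j with ⟨k, l⟩ | ⟨k, l⟩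
    · exact (pow_eq_zero_iff hq0).1 (congrFun (hcoeff _ (congrFun hA k)) l)
    · exact (pow_eq_zero_iff hq0).1 (congrFun (hcoeff _ (congrFun hB k)) l)
  have hHdeg : H.natDegree ≤ q * (h + 3 * n) := by
    have key : ∀ c : Fin (h + 2 * n) → F[X], (∀ k, (c k).natDegree ≤ L) →
        (∑ k : Fin (h + 2 * n), X ^ (q * (k : ℕ)) * c k).natDegree ≤ q * (h + 2 * n - 1) + L := by
      intro c hc
      refine natDegree_sum_le_of_forall_le _ _ fun k _ => ?_
      refine natDegree_mul_le.trans ?_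
      rw [natDegree_X_pow]
      exact Nat.add_le_add (Nat.mul_le_mul_left _ (Nat.le_sub_one_of_lt k.2)) (hc k)
    have hb : 2 * n * h + (q * (h + 2 * n - 1) + L) ≤ q * (h + 3 * n) := by
      obtain ⟨t, ht⟩ : ∃ t, h + 2 * n = t + 1 := ⟨h + 2 * n - 1, by omega⟩
      have : h + 3 * n = t + 1 + n := by omega
      rw [this, ht, Nat.add_sub_cancel, hq]
      nlinarith
    refine (natDegree_add_le _ _).trans (max_le ?_ ?_)
    · exact (key A fun k => hdegsum _).trans (le_trans (Nat.le_add_left _ _) hb)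
    · exact natDegree_mul_le.trans ((Nat.add_le_add hEdeg (key B fun k => hdegsum _)).trans hb)
  refine le_trans ?_ hHdeg
  have hroots : ({y : F | D.eval y ^ (h * (q + 1)) = ε} : Finset F) ⊆ H.roots.toFinset := by
    intro y hy
    rw [Finset.mem_filter] at hy
    have hy := hy.2
    rw [Multiset.mem_toFinset, mem_roots hH0, IsRoot]
    set e := D.eval y ^ h with he
    have hee : e ^ q * e = ε := by rw [← hy, he]; ring
    have he0 : e ≠ 0 := by rintro h; rw [h, mul_zero] at hee; exact hε hee.symm
    have hyQ : ∀ x : F, (x ^ q) ^ q = x := by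
      intro x
      rw [← pow_mul, ← sq, ← hF]
      exact FiniteField.pow_card x
    have hsumA : ∀ c : ι → F, (∑ k : Fin (h + 2 * n), y ^ (q * (k : ℕ)) *
        ∑ l : Fin (L + 1), c (k, l) ^ q * y ^ (l : ℕ)) ^ q =
        ∑ i : ι, c i * y ^ ((i.1 : ℕ) + q * i.2) := by
      intro c
      rw [Fintype.sum_prod_type, hqdef, sum_pow_char_pow]
      refine Finset.sum_congr rfl fun k _ => ?_
      rw [mul_pow, sum_pow_char_pow, Finset.mul_sum]
      refine Finset.sum_congr rfl fun l _ => ?_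
      rw [← hqdef, mul_pow, hyQ, mul_comm q, pow_mul, hyQ, pow_add, pow_mul,
        ← pow_mul, ← pow_mul]
      ring_nf
    have hHe : H.eval y = (∑ k : Fin (h + 2 * n), y ^ (q * (k : ℕ)) *
        ∑ l : Fin (L + 1), v (Sum.inl (k, l)) ^ q * y ^ (l : ℕ)) +
        e * (∑ k : Fin (h + 2 * n), y ^ (q * (k : ℕ)) *
        ∑ l : Fin (L + 1), v (Sum.inr (k, l)) ^ q * y ^ (l : ℕ)) := by
      simp [H, A, B, eval_finsetSum, hE, he]
    have h2 : e * (H.eval y) ^ q = 0 := by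
      have h3 := congrArg (eval y) hP
      rw [eval_finsetSum, Fintype.sum_sum_type] at h3
      simp only [w, Sum.elim_inl, Sum.elim_inr, eval_smul, eval_mul, eval_pow, eval_X, eval_C,
        smul_eq_mul, eval_zero, hE] at h3
      rw [hHe, hqdef, add_pow_char_pow, mul_pow, ← hqdef, hsumA fun i => v (Sum.inl i),
        hsumA fun i => v (Sum.inr i), ← h3, mul_add, ← mul_assoc, mul_comm e (e ^ q), hee,
        Finset.mul_sum, Finset.mul_sum]
      congr 1
      · exact Finset.sum_congr rfl fun i _ => by rw [he]; ring
      · exact Finset.sum_congr rfl fun i _ => by ring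
    have hq0 : q ≠ 0 := by omega
    exact (pow_eq_zero_iff hq0).1 ((mul_eq_zero.1 h2).resolve_left he0)
  exact (Finset.card_le_card hroots).trans
    ((Multiset.toFinset_card_le _).trans (card_roots' _))

theorem ringChar_ne_two_of_card_eq {F : Type*} [Field F] [Fintype F] {k : ℕ}
    (hF : Fintype.card F = 2 * k + 1) : ringChar F ≠ 2 := by
  intro h2
  have := FiniteField.even_card_of_char_two h2
  omega

theorem abs_sum_quadraticChar_eval_le {F : Type*} [Field F] [Fintype F] [DecidableEq F] {p : ℕ}
    [Fact p.Prime] [CharP F p] {r h n : ℕ} (hq : p ^ r = 2 * h + 1)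
    (hF : Fintype.card F = (p ^ r) ^ 2) {D : F[X]} (hD : Squarefree D) (hdeg : 0 < D.natDegree)
    (hn : D.natDegree ≤ 2 * n) (h0 : D.coeff 0 ≠ 0) (hnh : 2 * n ≤ h) :
    |∑ y : F, quadraticChar F (D.eval y)| ≤ 8 * n * p ^ r := by
  have hchar : ringChar F ≠ 2 :=
    ringChar_ne_two_of_card_eq (k := 2 * h * (h + 1)) (by rw [hF, hq]; ring)
  set q := p ^ r with hqdef
  have hhalf : Fintype.card F / 2 = h * (q + 1) := by
    rw [hF, hq]
    have : (2 * h + 1) ^ 2 = 1 + 2 * (h * (2 * h + 1 + 1)) := by ring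
    rw [this]
    omega
  have heq : ∀ a : F, (quadraticChar F a : F) = a ^ (h * (q + 1)) := by
    intro a
    rw [quadraticChar_eq_pow_of_char_ne_two' hchar, hhalf]
  let Z : ℤ → Finset F := fun ε => {y : F | quadraticChar F (D.eval y) = ε}
  have hZ : ∀ ε : ℤ, (ε : F) ≠ 0 → #(Z ε) ≤ q * (h + 3 * n) := by
    intro ε hε
    refine le_trans (Finset.card_le_card ?_)
      (card_filter_eval_pow_eq_le hq hF hD hdeg hn h0 hnh hε)
    intro y hy
    rw [Finset.mem_filter] at hy ⊢
    exact ⟨hy.1, by rw [← hqdef, ← heq, hy.2]⟩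
  have h1 := hZ 1 (by simp)
  have h2 := hZ (-1) (by simp)
  have hZ0 : #(Z 0) ≤ 2 * n := by
    have hDne : D ≠ 0 := by rintro rfl; simp at hdeg
    refine le_trans ?_ ((Multiset.toFinset_card_le _).trans ((card_roots' D).trans hn))
    refine Finset.card_le_card fun y hy => ?_
    rw [Finset.mem_filter] at hy
    rw [Multiset.mem_toFinset, mem_roots hDne, IsRoot]
    exact quadraticChar_eq_zero_iff.1 hy.2
  have htri : ∀ a : F, (quadraticChar F a = 1 ∨ quadraticChar F a = -1) ∨
      quadraticChar F a = 0 := by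
    intro a
    by_cases ha : a = 0
    · right; rw [ha]; exact quadraticChar_zero
    · left; exact quadraticChar_dichotomy ha
  have hcardZ : ∀ ε : ℤ, (#(Z ε) : ℤ) =
      ∑ y : F, if quadraticChar F (D.eval y) = ε then 1 else 0 := by
    intro ε
    rw [Finset.card_filter]
    push_cast
    rfl
  have hsum : ∑ y : F, quadraticChar F (D.eval y) = #(Z 1) - #(Z (-1)) := by
    rw [hcardZ, hcardZ, ← Finset.sum_sub_distrib]
    refine Finset.sum_congr rfl fun y _ => ?_
    rcases htri (D.eval y) with (h | h) | h <;> simp [h]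
  have htot : (#(Z 1) : ℤ) + #(Z (-1)) + #(Z 0) = (q : ℤ) ^ 2 := by
    rw [hcardZ, hcardZ, hcardZ, ← Finset.sum_add_distrib, ← Finset.sum_add_distrib]
    have : (q : ℤ) ^ 2 = ∑ y : F, 1 := by simp [hF]
    rw [this]
    refine Finset.sum_congr rfl fun y _ => ?_
    rcases htri (D.eval y) with (h | h) | h <;> simp [h]
  rw [hsum]
  zify at h1 h2 hZ0 hq
  have hq' : (1 : ℤ) ≤ q := by omega
  have hmul : (n : ℤ) ≤ n * q := by nlinarith
  have hp : (p : ℤ) ^ r = q := by rw [hqdef]; push_cast; rfl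
  rw [hp]
  have hsq : (q : ℤ) ^ 2 = 2 * (q * h) + q := by rw [sq]; nth_rw 2 [hq]; ring
  rw [abs_le]
  constructor <;> nlinarith

theorem card_filter_sq_eq {F : Type*} [Field F] [Fintype F] [DecidableEq F] (hF : ringChar F ≠ 2)
    (a : F) : (#{x : F | x ^ 2 = a} : ℤ) = quadraticChar F a + 1 := by
  rw [← quadraticChar_card_sqrts hF a]
  congr 2
  ext x
  simp

/-- The Kloosterman sum over a finite commutative ring attached to an additive character. -/
noncomputable def kloostermanSum {R : Type*} [CommRing R] [Fintype R] [DecidableEq R]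
    (ψ : AddChar R ℂ) (a : R) : ℂ :=
  ∑ x : Rˣ, ψ (a * x + ((x⁻¹ : Rˣ) : R))

theorem kloostermanSum_eq_sum_quadraticChar {F : Type*} [Field F] [Fintype F] [DecidableEq F]
    (hF : ringChar F ≠ 2) {ψ : AddChar F ℂ} (hψ : ψ ≠ 0) {a : F} (ha : a ≠ 0) :
    kloostermanSum ψ a = ∑ t : F, ψ t * (quadraticChar F (t ^ 2 - 4 * a) : ℂ) := by
  have h2 : (2 : F) ≠ 0 := Ring.two_ne_zero hF
  have hfib : ∀ t : F, (#{x : Fˣ | a * x + ((x⁻¹ : Fˣ) : F) = t} : ℂ) =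
      (quadraticChar F (t ^ 2 - 4 * a) : ℂ) + 1 := by
    intro t
    have : (#{x : Fˣ | a * x + ((x⁻¹ : Fˣ) : F) = t} : ℤ) =
        quadraticChar F (t ^ 2 - 4 * a) + 1 := by
      rw [← card_filter_sq_eq hF, Nat.cast_inj]
      refine Finset.card_bij (fun x _ => 2 * a * (x : F) - t) ?_ ?_ ?_
      · intro x hx
        rw [Finset.mem_filter] at hx ⊢
        refine ⟨Finset.mem_univ _, ?_⟩
        have hx' := hx.2
        have hxx : (x : F) * ((x⁻¹ : Fˣ) : F) = 1 := x.mul_inv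
        rw [← hx']
        linear_combination (-4 * a) * hxx
      · intro x _ y _ hxy
        have : (2 * a) * (x : F) = (2 * a) * (y : F) := by linear_combination hxy
        exact Units.ext (mul_left_cancel₀ (mul_ne_zero h2 ha) this)
      · intro s hs
        rw [Finset.mem_filter] at hs
        have hs' := hs.2
        have hne : (s + t) / (2 * a) ≠ 0 := by
          intro h
          have hst : s = -t := by
            rw [div_eq_zero_iff] at h
            exact eq_neg_of_add_eq_zero_left (h.resolve_right (mul_ne_zero h2 ha))
          rw [hst] at hs'
          have : (2 * 2) * a = 0 := by linear_combination hs'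
          exact mul_ne_zero (mul_ne_zero h2 h2) ha this
        refine ⟨Units.mk0 _ hne, ?_, ?_⟩
        · rw [Finset.mem_filter]
          refine ⟨Finset.mem_univ _, ?_⟩
          rw [Units.val_inv_eq_inv_val, Units.val_mk0]
          have hst : s + t ≠ 0 := fun h => hne (by rw [h, zero_div])
          field_simp
          linear_combination hs'
        · simp only [Units.val_mk0]
          field_simp
          ring
    exact_mod_cast this
  have h1 : kloostermanSum ψ a =
      ∑ t : F, ψ t * ((quadraticChar F (t ^ 2 - 4 * a) : ℂ) + 1) := by
    rw [kloostermanSum, ← Finset.sum_fiberwise (s := univ)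
      (g := fun x : Fˣ => a * x + ((x⁻¹ : Fˣ) : F))]
    refine Finset.sum_congr rfl fun t _ => ?_
    rw [← hfib, Finset.sum_congr rfl (g := fun _ => ψ t), Finset.sum_const, nsmul_eq_mul, mul_comm]
    intro x hx
    rw [(Finset.mem_filter.1 hx).2]
  rw [h1]
  simp only [mul_add, mul_one, Finset.sum_add_distrib]
  rw [AddChar.sum_eq_zero_iff_ne_zero.2 hψ, add_zero]

theorem norm_kloostermanSum_le_of_card_eq_sq {F : Type*} [Field F] [Fintype F] [DecidableEq F]
    {p : ℕ} [Fact p.Prime] [CharP F p] {r h : ℕ} (hq : p ^ r = 2 * h + 1)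
    (hF : Fintype.card F = (p ^ r) ^ 2) (hph : 2 * p ≤ h) {ψ : AddChar F ℂ} (hψ : ψ ≠ 0)
    (hfrob : ∀ x, ψ (x ^ p) = ψ x) {a : F} (ha : a ≠ 0) :
    ‖kloostermanSum ψ a‖ ≤ 8 * p * p ^ r + 2 := by
  have hp : p.Prime := Fact.out
  have hchar : ringChar F ≠ 2 :=
    ringChar_ne_two_of_card_eq (k := 2 * h * (h + 1)) (by rw [hF, hq]; ring)
  have h2 : (2 : F) ≠ 0 := Ring.two_ne_zero hchar
  have h4a : 4 * a ≠ 0 := by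
    have : (4 : F) = 2 * 2 := by norm_num
    rw [this]; exact mul_ne_zero (mul_ne_zero h2 h2) ha
  let T : F → ℤ := fun c => ∑ y : F, quadraticChar F ((y ^ p - y + c) ^ 2 - 4 * a)
  have hT : ∀ c : F, c ^ 2 ≠ 4 * a → |T c| ≤ 8 * p * p ^ r := by
    intro c hc
    let g : F[X] := X ^ p - X + C c
    let D : F[X] := g ^ 2 - C (4 * a)
    have hg : g.natDegree = p := by
      have : g = X ^ p - (X - C c) := by simp only [g]; ring
      rw [this, natDegree_sub_eq_left_of_natDegree_lt]
      · simp
      · rw [natDegree_X_sub_C, natDegree_X_pow]; exact hp.one_lt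
    have hDdeg : D.natDegree = 2 * p := by
      rw [natDegree_sub_C, natDegree_pow, hg]
    have hder : derivative D = -2 * g := by
      simp only [D, g, derivative_sub, derivative_pow, derivative_add, derivative_X, derivative_C]
      simp
      exact Or.inl rfl
    have hsq : Squarefree D := by
      apply Separable.squarefree
      refine ⟨C (-(4 * a)⁻¹), C (-(4 * a)⁻¹) * C 2⁻¹ * g, ?_⟩
      have e1 : (C (2⁻¹ : F)) * 2 = 1 := by
        rw [show (2 : F[X]) = C 2 from rfl, ← C_mul, inv_mul_cancel₀ h2, C_1]
      have e2 : C (-(4 * a)⁻¹) * C (4 * a) = -1 := by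
        rw [← C_mul, neg_mul, inv_mul_cancel₀ h4a, C_neg, C_1]
      rw [hder]
      simp only [D]
      linear_combination (-C (-(4 * a)⁻¹) * g ^ 2) * e1 - e2
    have h0 : D.coeff 0 ≠ 0 := by
      rw [coeff_zero_eq_eval_zero]
      simp only [D, g, eval_sub, eval_pow, eval_add, eval_X, eval_C]
      rw [zero_pow hp.ne_zero]
      simpa [sub_eq_zero] using hc
    have := abs_sum_quadraticChar_eval_le (n := p) hq hF hsq (by rw [hDdeg]; have := hp.pos; omega)
      hDdeg.le h0 hph
    simpa [D, g, T] using this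
  have hT' : ∀ c : F, |T c| ≤ ((p : ℤ) ^ r) ^ 2 := by
    intro c
    refine (Finset.abs_sum_le_sum_abs _ _).trans ?_
    have h1 : ∀ x : F, |quadraticChar F x| ≤ 1 := by
      intro x
      by_cases hx : x = 0
      · simp [hx]
      · rcases quadraticChar_dichotomy hx with h | h <;> simp [h]
    refine (Finset.sum_le_sum fun y _ => h1 _).trans ?_
    rw [Finset.sum_const, Finset.card_univ, hF, nsmul_eq_mul]
    push_cast
    rw [mul_one]
  have hψy : ∀ y c : F, ψ (y ^ p - y + c) = ψ c := by
    intro y c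
    rw [AddChar.map_add_eq_mul, AddChar.map_sub_eq_div, hfrob, div_self, one_mul]
    exact (ψ.val_isUnit y).ne_zero
  have havg : (Fintype.card F : ℂ) * kloostermanSum ψ a = ∑ c : F, ψ c * (T c : ℂ) := by
    rw [kloostermanSum_eq_sum_quadraticChar hchar hψ ha]
    have : ∀ y : F, ∑ t : F, ψ t * (quadraticChar F (t ^ 2 - 4 * a) : ℂ) =
        ∑ c : F, ψ c * (quadraticChar F ((y ^ p - y + c) ^ 2 - 4 * a) : ℂ) := by
      intro y
      rw [← Equiv.sum_comp (Equiv.addLeft (y ^ p - y))]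
      refine Finset.sum_congr rfl fun c _ => ?_
      rw [Equiv.coe_addLeft, hψy]
    have h3 : (Fintype.card F : ℂ) * ∑ t : F, ψ t * (quadraticChar F (t ^ 2 - 4 * a) : ℂ) =
        ∑ y : F, ∑ t : F, ψ t * (quadraticChar F (t ^ 2 - 4 * a) : ℂ) := by
      rw [Finset.sum_const, Finset.card_univ, nsmul_eq_mul]
    rw [h3, Finset.sum_congr rfl fun y _ => this y, Finset.sum_comm]
    refine Finset.sum_congr rfl fun c _ => ?_
    simp only [T]
    push_cast
    rw [Finset.mul_sum]
  have hcardpos : (0 : ℝ) < Fintype.card F := by exact_mod_cast Fintype.card_pos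
  have hbound : (Fintype.card F : ℝ) * ‖kloostermanSum ψ a‖ ≤
      Fintype.card F * (8 * p * p ^ r) + 2 * Fintype.card F := by
    have e1 : (Fintype.card F : ℝ) * ‖kloostermanSum ψ a‖ =
        ‖(Fintype.card F : ℂ) * kloostermanSum ψ a‖ := by simp
    rw [e1, havg]
    refine (norm_sum_le _ _).trans ?_
    have e2 : ∀ c : F, ‖ψ c * (T c : ℂ)‖ ≤ (8 * p * p ^ r : ℝ) +
        if c ^ 2 = 4 * a then (Fintype.card F : ℝ) else 0 := by
      intro c
      rw [norm_mul, AddChar.norm_apply, one_mul, Complex.norm_intCast]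
      split_ifs with hc
      · have h5 : (|T c| : ℝ) ≤ (Fintype.card F : ℝ) := by
          rw [hF]
          have := hT' c
          exact_mod_cast this
        have : (0 : ℝ) ≤ 8 * p * p ^ r := by positivity
        linarith
      · rw [add_zero]
        exact_mod_cast hT c hc
    refine (Finset.sum_le_sum fun c _ => e2 c).trans ?_
    rw [Finset.sum_add_distrib, Finset.sum_const, Finset.card_univ, nsmul_eq_mul,
      ← Finset.sum_filter, Finset.sum_const, nsmul_eq_mul]
    have h6 : #{c : F | c ^ 2 = 4 * a} ≤ 2 := by
      have h7 := card_filter_sq_eq hchar (4 * a)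
      rcases quadraticChar_dichotomy h4a with h | h <;> rw [h] at h7 <;> omega
    have h8 : (#{c : F | c ^ 2 = 4 * a} : ℝ) ≤ 2 := by exact_mod_cast h6
    gcongr
  have : (Fintype.card F : ℝ) * ‖kloostermanSum ψ a‖ ≤
      Fintype.card F * (8 * p * p ^ r + 2) := by linarith
  exact le_of_mul_le_mul_left this hcardpos

end Stepanov

section QuadraticExtension

variable {F K : Type*} [Field F] [Fintype F] [Field K] [Fintype K] [Algebra F K]

theorem algebraMap_trace_of_finrank_eq_two (h : Module.finrank F K = 2) (z : K) :
    algebraMap F K (Algebra.trace F K z) = z + z ^ Fintype.card F := by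
  rw [FiniteField.algebraMap_trace_eq_sum_pow, h]
  simp [Finset.sum_range_succ]

theorem algebraMap_norm_of_finrank_eq_two (h : Module.finrank F K = 2) (z : K) :
    algebraMap F K (Algebra.norm F z) = z * z ^ Fintype.card F := by
  rw [FiniteField.algebraMap_norm_eq_prod_pow, h]
  simp [Finset.prod_range_succ]

variable [DecidableEq F] [DecidableEq K]

theorem card_roots_add_card_trace_norm_eq_two (h : Module.finrank F K = 2) (hF : ringChar F ≠ 2)
    (u v : F) : #{x : F | x * (u - x) = v} +
      #{z : K | Algebra.trace F K z = u ∧ Algebra.norm F z = v} = 2 := by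
  have h2 : (2 : F) ≠ 0 := Ring.two_ne_zero hF
  have h2K : (2 : K) ≠ 0 := by
    have := (map_ne_zero (algebraMap F K)).2 h2
    rwa [map_ofNat] at this
  have hK : ringChar K ≠ 2 := fun hc => h2K (by
    have := CharP.cast_eq_zero K (ringChar K)
    rwa [hc] at this)
  obtain ⟨s, hs⟩ : ∃ s, Fintype.card F = 2 * s + 1 :=
    ⟨Fintype.card F / 2, by have := FiniteField.odd_card_of_char_ne_two hF; omega⟩
  have hhalf : Fintype.card F / 2 = s := by omega
  set Δ := u ^ 2 - 4 * v with hΔ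
  set q := Fintype.card F with hq
  let ι := algebraMap F K
  have hι : Function.Injective ι := (algebraMap F K).injective
  have hcardK : Fintype.card K = q ^ 2 := by rw [Module.card_eq_pow_finrank (K := F), h]
  have hχ : ι (quadraticChar F Δ : F) = ι Δ ^ s := by
    rw [quadraticChar_eq_pow_of_char_ne_two' hF, map_pow, hhalf]
  have hA : (#{x : F | x * (u - x) = v} : ℤ) = quadraticChar F Δ + 1 := by
    rw [← card_filter_sq_eq hF, Nat.cast_inj]
    refine Finset.card_bij (fun x _ => 2 * x - u) ?_ ?_ ?_
    · intro x hx
      rw [Finset.mem_filter] at hx ⊢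
      exact ⟨Finset.mem_univ _, by rw [hΔ, ← hx.2]; ring⟩
    · intro x _ y _ hxy
      exact mul_left_cancel₀ h2 (by linear_combination hxy)
    · intro w hw
      rw [Finset.mem_filter] at hw
      refine ⟨(w + u) / 2, ?_, by field_simp; ring⟩
      rw [Finset.mem_filter]
      refine ⟨Finset.mem_univ _, mul_left_cancel₀ (mul_ne_zero h2 h2) ?_⟩
      have := hw.2
      field_simp
      rw [hΔ] at this
      linear_combination -this
  have hB : #{z : K | Algebra.trace F K z = u ∧ Algebra.norm F z = v} =
      #{w : K | w ^ 2 = ι Δ ∧ w ^ q = -w} := by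
    have hqpow : ∀ z : K, (2 * z - ι u) ^ q = 2 * z ^ q - ι u := by
      intro z
      have e1 := FiniteField.coe_frobeniusAlgHom F K
      have e2 : ∀ z : K, FiniteField.frobeniusAlgHom F K z = z ^ q := fun z => congrFun e1 z
      rw [← e2, map_sub, map_mul, map_ofNat, e2]
      congr 1
      exact (FiniteField.frobeniusAlgHom F K).commutes u
    have hmem : ∀ z : K, (Algebra.trace F K z = u ∧ Algebra.norm F z = v) ↔
        ((2 * z - ι u) ^ 2 = ι Δ ∧ (2 * z - ι u) ^ q = -(2 * z - ι u)) := by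
      intro z
      rw [← hι.eq_iff, ← hι.eq_iff (a := Algebra.norm F z), hqpow]
      simp only [ι]
      rw [algebraMap_trace_of_finrank_eq_two h, algebraMap_norm_of_finrank_eq_two h, ← hq]
      have hΔ' : algebraMap F K Δ = algebraMap F K u ^ 2 - 4 * algebraMap F K v := by
        rw [hΔ, map_sub, map_pow, map_mul, map_ofNat]
      rw [hΔ']
      constructor
      · rintro ⟨ht, hn⟩
        refine ⟨?_, by linear_combination 2 * ht⟩
        linear_combination 4 * z * ht - 4 * hn
      · rintro ⟨hd, hw⟩
        have ht : z + z ^ q = algebraMap F K u := mul_left_cancel₀ h2K (by linear_combination hw)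
        refine ⟨ht, mul_left_cancel₀ (mul_ne_zero h2K h2K) ?_⟩
        linear_combination 4 * z * ht - hd
    refine Finset.card_bij (fun z _ => 2 * z - ι u) ?_ ?_ ?_
    · intro z hz
      rw [Finset.mem_filter] at hz ⊢
      exact ⟨Finset.mem_univ _, (hmem z).1 hz.2⟩
    · intro x _ y _ hxy
      exact mul_left_cancel₀ h2K (by linear_combination hxy)
    · intro w hw
      rw [Finset.mem_filter] at hw
      have hw' : 2 * ((w + ι u) / 2) - ι u = w := by field_simp; ring
      refine ⟨(w + ι u) / 2, ?_, hw'⟩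
      rw [Finset.mem_filter, hmem, hw']
      exact ⟨Finset.mem_univ _, hw.2⟩
  have hwq : ∀ w : K, w ^ 2 = ι Δ → w ^ q = w * ι (quadraticChar F Δ : F) := by
    intro w hw
    rw [hχ, ← hw, hs]; ring
  rw [hB]
  by_cases hΔ0 : Δ = 0
  · rw [hΔ0, quadraticChar_zero, zero_add] at hA
    have : ({w : K | w ^ 2 = ι Δ ∧ w ^ q = -w} : Finset K) = {0} := by
      ext w
      rw [Finset.mem_filter, Finset.mem_singleton, hΔ0, map_zero]
      refine ⟨fun hw => pow_eq_zero_iff two_ne_zero |>.1 hw.2.1, ?_⟩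
      rintro rfl
      have : q ≠ 0 := by omega
      simp [this]
    rw [this, Finset.card_singleton]
    omega
  · rcases quadraticChar_dichotomy hΔ0 with hc | hc
    · have : ({w : K | w ^ 2 = ι Δ ∧ w ^ q = -w} : Finset K) = ∅ := by
        refine Finset.filter_eq_empty_iff.2 fun w _ hw => ?_
        have h1 := hwq w hw.1
        rw [hc, hw.2, Int.cast_one, map_one, mul_one] at h1
        have h3 : 2 * w = 0 := by linear_combination -h1
        have h4 := (mul_eq_zero.1 h3).resolve_left h2K
        rw [h4, zero_pow two_ne_zero] at hw
        exact hΔ0 (hι (by rw [← hw.1, map_zero]))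
      rw [this, Finset.card_empty]
      rw [hc] at hA
      omega
    · have : ({w : K | w ^ 2 = ι Δ ∧ w ^ q = -w} : Finset K) =
          ({w : K | w ^ 2 = ι Δ} : Finset K) := by
        ext w
        rw [Finset.mem_filter, Finset.mem_filter]
        refine ⟨fun hw => ⟨hw.1, hw.2.1⟩, fun hw => ⟨hw.1, hw.2, ?_⟩⟩
        rw [hwq w hw.2, hc]
        simp
      rw [this]
      have h5 := card_filter_sq_eq hK (ι Δ)
      have hιΔ : ι Δ ≠ 0 := (map_ne_zero ι).2 hΔ0
      have h6 : quadraticChar K (ι Δ) = 1 := by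
        rcases quadraticChar_dichotomy hιΔ with h' | h'
        · exact h'
        exfalso
        have h7 := quadraticChar_eq_pow_of_char_ne_two' hK (ι Δ)
        have h8 : Fintype.card K / 2 = s * (2 * (s + 1)) := by
          rw [hcardK, hs]
          have : (2 * s + 1) ^ 2 = 1 + 2 * (s * (2 * (s + 1))) := by ring
          omega
        rw [h8, pow_mul, ← hχ, hc, h', pow_mul] at h7
        simp at h7
        exact h2K (by linear_combination -h7)
      rw [h6] at h5
      rw [hc] at hA
      omega

theorem kloostermanSum_trace_add_sq (h : Module.finrank F K = 2) (hF : ringChar F ≠ 2)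
    {ψ : AddChar F ℂ} (hψ : ψ ≠ 0) {a : F} (ha : a ≠ 0) :
    kloostermanSum (ψ.compAddMonoidHom (Algebra.trace F K).toAddMonoidHom) (algebraMap F K a) +
      kloostermanSum ψ a ^ 2 = 2 * Fintype.card F := by
  let φ : F → Fˣ → ℂ := fun u v => ψ (u * (a + ((v⁻¹ : Fˣ) : F)))
  have hn1 : ∀ (u : F) (v : Fˣ), #{x : Fˣ | (x : F) + v * ((x⁻¹ : Fˣ) : F) = u} =
      #{x : F | x * (u - x) = v} := by
    intro u v
    refine Finset.card_bij (fun x _ => (x : F)) ?_ (fun x _ y _ hxy => Units.ext hxy) ?_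
    · intro x hx
      rw [Finset.mem_filter] at hx ⊢
      refine ⟨Finset.mem_univ _, ?_⟩
      rw [← hx.2]
      linear_combination (v : F) * x.mul_inv
    · intro x hx
      rw [Finset.mem_filter] at hx
      have hx0 : x ≠ 0 := by
        rintro rfl
        exact v.ne_zero (by rw [← hx.2, zero_mul])
      refine ⟨Units.mk0 x hx0, ?_, rfl⟩
      rw [Finset.mem_filter, Units.val_inv_eq_inv_val, Units.val_mk0]
      refine ⟨Finset.mem_univ _, ?_⟩
      rw [← hx.2]
      field_simp
      ring
  have hS1 : kloostermanSum ψ a ^ 2 = ∑ v : Fˣ, ∑ u : F, φ u v * #{x : F | x * (u - x) = v} := by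
    rw [sq, kloostermanSum, Finset.sum_mul_sum]
    have e1 : ∀ x : Fˣ, ∑ y : Fˣ, ψ (a * x + ((x⁻¹ : Fˣ) : F)) * ψ (a * y + ((y⁻¹ : Fˣ) : F)) =
        ∑ v : Fˣ, φ (x + v * ((x⁻¹ : Fˣ) : F)) v := by
      intro x
      rw [← Equiv.sum_comp (Equiv.mulLeft x⁻¹)]
      refine Finset.sum_congr rfl fun v _ => ?_
      rw [← AddChar.map_add_eq_mul]
      simp only [φ, Equiv.coe_mulLeft]
      congr 1
      rw [mul_inv_rev, inv_inv, Units.val_mul, Units.val_mul]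
      linear_combination (-((x⁻¹ : Fˣ) : F)) * v.mul_inv
    rw [Finset.sum_congr rfl fun x _ => e1 x, Finset.sum_comm]
    refine Finset.sum_congr rfl fun v _ => ?_
    rw [← Finset.sum_fiberwise (s := univ) (g := fun x : Fˣ => (x : F) + v * ((x⁻¹ : Fˣ) : F))]
    refine Finset.sum_congr rfl fun u _ => ?_
    rw [← hn1, Finset.sum_congr rfl (g := fun _ => φ u v), Finset.sum_const, nsmul_eq_mul, mul_comm]
    intro x hx
    rw [(Finset.mem_filter.1 hx).2]
  have hn2 : ∀ (u : F) (v : Fˣ),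
      #{z : Kˣ | (Units.map (Algebra.norm F : K →* F) z, Algebra.trace F K z) = (v, u)} =
      #{z : K | Algebra.trace F K z = u ∧ Algebra.norm F z = v} := by
    intro u v
    refine Finset.card_bij (fun x _ => (x : K)) ?_ (fun x _ y _ hxy => Units.ext hxy) ?_
    · intro z hz
      rw [Finset.mem_filter] at hz ⊢
      rw [Prod.mk.injEq, Units.ext_iff] at hz
      exact ⟨Finset.mem_univ _, hz.2.2, hz.2.1⟩
    · intro z hz
      rw [Finset.mem_filter] at hz
      have hz0 : z ≠ 0 := by
        rintro rfl
        have := hz.2.2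
        rw [Algebra.norm_zero] at this
        exact v.ne_zero this.symm
      refine ⟨Units.mk0 z hz0, ?_, rfl⟩
      rw [Finset.mem_filter, Prod.mk.injEq, Units.ext_iff]
      exact ⟨Finset.mem_univ _, hz.2.2, hz.2.1⟩
  have hS2 : kloostermanSum (ψ.compAddMonoidHom (Algebra.trace F K).toAddMonoidHom)
      (algebraMap F K a) = ∑ v : Fˣ, ∑ u : F,
        φ u v * #{z : K | Algebra.trace F K z = u ∧ Algebra.norm F z = v} := by
    rw [kloostermanSum, ← Fintype.sum_prod_type',
      ← Finset.sum_fiberwise (s := univ)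
        (g := fun z : Kˣ => (Units.map (Algebra.norm F : K →* F) z, Algebra.trace F K z))]
    refine Finset.sum_congr rfl fun uv _ => ?_
    obtain ⟨v, u⟩ := uv
    rw [← hn2, Finset.sum_congr rfl (g := fun _ => φ u v), Finset.sum_const, nsmul_eq_mul, mul_comm]
    intro z hz
    rw [Finset.mem_filter, Prod.mk.injEq] at hz
    obtain ⟨-, hv, hu⟩ := hz
    have htr : Algebra.trace F K ((z⁻¹ : Kˣ) : K) = u * ((v⁻¹ : Fˣ) : F) := by
      apply (algebraMap F K).injective
      have hz0 : (z : K) ≠ 0 := z.ne_zero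
      rw [← hu, ← hv, map_mul, Units.val_inv_eq_inv_val, Units.val_inv_eq_inv_val, Units.coe_map,
        map_inv₀ (algebraMap F K)]
      change _ = _ * (algebraMap F K (Algebra.norm F (z : K)))⁻¹
      rw [algebraMap_trace_of_finrank_eq_two h, algebraMap_norm_of_finrank_eq_two h,
        algebraMap_trace_of_finrank_eq_two h]
      field_simp
      rw [one_div, inv_pow]
      field_simp
      ring
    rw [AddChar.compAddMonoidHom_apply]
    simp only [φ]
    congr 1
    change Algebra.trace F K _ = _
    rw [map_add, ← Algebra.smul_def, map_smul, htr, hu, smul_eq_mul]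
    ring
  rw [hS1, hS2, ← Finset.sum_add_distrib]
  have hinner : ∀ v : Fˣ,
      (∑ u : F, φ u v * #{z : K | Algebra.trace F K z = u ∧ Algebra.norm F z = v}) +
      (∑ u : F, φ u v * #{x : F | x * (u - x) = v}) =
      if v = Units.mk0 (-a⁻¹) (neg_ne_zero.2 (inv_ne_zero ha)) then
        2 * (Fintype.card F : ℂ) else 0 := by
    intro v
    rw [← Finset.sum_add_distrib]
    have e1 : ∀ u : F, φ u v * #{z : K | Algebra.trace F K z = u ∧ Algebra.norm F z = v} +
        φ u v * #{x : F | x * (u - x) = v} = 2 * ψ (u * (a + ((v⁻¹ : Fˣ) : F))) := by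
      intro u
      have := card_roots_add_card_trace_norm_eq_two (K := K) h hF u v
      rw [← mul_add, mul_comm]
      congr 1
      rw [add_comm]
      exact_mod_cast this
    rw [Finset.sum_congr rfl fun u _ => e1 u, ← Finset.mul_sum,
      AddChar.sum_mulShift _ (AddChar.IsPrimitive.of_ne_one hψ)]
    have e2 : a + ((v⁻¹ : Fˣ) : F) = 0 ↔ v = Units.mk0 (-a⁻¹) (neg_ne_zero.2 (inv_ne_zero ha)) := by
      rw [Units.ext_iff, Units.val_mk0, Units.val_inv_eq_inv_val, add_eq_zero_iff_eq_neg,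
        ← inv_neg, ← inv_eq_iff_eq_inv, eq_comm, neg_eq_iff_eq_neg]
    simp only [e2]
    split_ifs <;> simp
  rw [Finset.sum_congr rfl fun v _ => hinner v, Finset.sum_ite_eq' univ, if_pos (Finset.mem_univ _)]

end QuadraticExtension

section PrimeModulus

theorem exists_quadratic_extension_kloostermanSum {p : ℕ} [Fact p.Prime] (hp : p ≠ 2)
    {F : Type} [Field F] [Fintype F] [DecidableEq F] [CharP F p] {ψ : AddChar F ℂ} (hψ : ψ ≠ 0)
    (hfrob : ∀ x, ψ (x ^ p) = ψ x) {a : F} (ha : a ≠ 0) :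
    ∃ (K : Type) (_ : Field K) (_ : Fintype K) (_ : DecidableEq K) (_ : CharP K p)
      (ψ' : AddChar K ℂ) (a' : K), ψ' ≠ 0 ∧ (∀ x, ψ' (x ^ p) = ψ' x) ∧ a' ≠ 0 ∧
        Fintype.card K = Fintype.card F ^ 2 ∧
        kloostermanSum ψ' a' + kloostermanSum ψ a ^ 2 = 2 * Fintype.card F := by
  classical
  let K := FiniteField.Extension F p 2
  let _ : Fintype K := Fintype.ofFinite K
  have hfin : Module.finrank F K = 2 := FiniteField.finrank_extension F p 2
  have hchar : ringChar F ≠ 2 := by rwa [ringChar.eq F p]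
  have _ : CharP K p := charP_of_injective_algebraMap (algebraMap F K).injective p
  refine ⟨K, inferInstance, inferInstance, inferInstance, inferInstance,
    ψ.compAddMonoidHom (Algebra.trace F K).toAddMonoidHom, algebraMap F K a, ?_, ?_, ?_, ?_,
    kloostermanSum_trace_add_sq hfin hchar hψ ha⟩
  · obtain ⟨x, hx⟩ := AddChar.ne_zero_iff.1 hψ
    obtain ⟨z, rfl⟩ := Algebra.trace_surjective F K x
    exact AddChar.ne_zero_iff.2 ⟨z, hx⟩
  · intro z
    have : Algebra.trace F K (z ^ p) = Algebra.trace F K z ^ p := by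
      apply (algebraMap F K).injective
      rw [map_pow (algebraMap F K), algebraMap_trace_of_finrank_eq_two hfin,
        algebraMap_trace_of_finrank_eq_two hfin, add_pow_char, ← pow_mul, ← pow_mul, mul_comm p]
    change ψ (Algebra.trace F K (z ^ p)) = ψ (Algebra.trace F K z)
    rw [this, hfrob]
  · exact (map_ne_zero _).2 ha
  · rw [Module.card_eq_pow_finrank (K := F), hfin]

/-- The bound `B √q` for Kloosterman sums over the finite fields of characteristic `p` having
`q ≥ N` elements. -/
def KloostermanBound (p N : ℕ) (B : ℝ) : Prop :=
  ∀ (F : Type) [Field F] [Fintype F] [DecidableEq F] [CharP F p] (ψ : AddChar F ℂ) (a : F),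
    ψ ≠ 0 → (∀ x, ψ (x ^ p) = ψ x) → a ≠ 0 → N ≤ Fintype.card F →
      ‖kloostermanSum ψ a‖ ≤ B * √(Fintype.card F)

theorem norm_le_of_add_sq_eq {z w : ℂ} {q : ℕ} {δ : ℝ} (hδ : 0 ≤ δ) (h : w + z ^ 2 = 2 * q)
    (hw : ‖w‖ ≤ (2 + 4 * δ) * q) : ‖z‖ ≤ (2 + δ) * √q := by
  refine le_of_sq_le_sq ?_ (by positivity)
  rw [← norm_pow, eq_sub_of_add_eq' h, mul_pow, Real.sq_sqrt q.cast_nonneg]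
  refine (norm_sub_le _ _).trans ?_
  rw [norm_mul, Complex.norm_natCast, Complex.norm_ofNat]
  nlinarith [mul_nonneg (sq_nonneg δ) (q.cast_nonneg (α := ℝ))]

theorem KloostermanBound.descend {p N N' : ℕ} [Fact p.Prime] (hp : p ≠ 2) {δ : ℝ} (hδ : 0 ≤ δ)
    (hN : N ≤ N' ^ 2) (h : KloostermanBound p N (2 + 4 * δ)) : KloostermanBound p N' (2 + δ) := by
  intro F _ _ _ _ ψ a hψ hfrob ha hF
  obtain ⟨K, _, _, _, _, ψ', a', hψ', hfrob', ha', hK, hS⟩ :=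
    exists_quadratic_extension_kloostermanSum hp hψ hfrob ha
  refine norm_le_of_add_sq_eq hδ hS ?_
  have := h K ψ' a' hψ' hfrob' ha' (hN.trans (hK ▸ Nat.pow_le_pow_left hF 2))
  rwa [hK, Nat.cast_pow, Real.sqrt_sq (Nat.cast_nonneg _)] at this

theorem kloostermanBound_of_stepanov {p : ℕ} [Fact p.Prime] (hp : p ≠ 2) :
    KloostermanBound p (4 * p + 1) (2 + 2 * p) := by
  intro F _ _ _ _ ψ a hψ hfrob ha hF
  obtain ⟨K, _, _, _, _, ψ', a', hψ', hfrob', ha', hK, hS⟩ :=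
    exists_quadratic_extension_kloostermanSum hp hψ hfrob ha
  refine norm_le_of_add_sq_eq (by positivity) hS ?_
  obtain ⟨r, -, hr⟩ := FiniteField.card F p
  obtain ⟨h, hh⟩ : Odd (p ^ (r : ℕ)) := ((Fact.out : p.Prime).odd_of_ne_two hp).pow
  rw [hr] at hK hF ⊢
  have := norm_kloostermanSum_le_of_card_eq_sq hh hK (by omega) hψ' hfrob' ha'
  refine this.trans ?_
  have h1 : (1 : ℝ) ≤ (p ^ (r : ℕ) : ℕ) := by exact_mod_cast (by omega : 1 ≤ p ^ (r : ℕ))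
  push_cast at h1 ⊢
  linarith

theorem kloostermanBound_add_div_pow {p : ℕ} [Fact p.Prime] (hp : p ≠ 2) (n : ℕ) :
    KloostermanBound p (4 * p + 1) (2 + 2 * p / 4 ^ n) := by
  induction n with
  | zero => simpa using kloostermanBound_of_stepanov hp
  | succ n ih =>
    refine KloostermanBound.descend hp (by positivity) (Nat.le_self_pow two_ne_zero _) ?_
    convert ih using 2
    field_simp
    ring

theorem kloostermanBound_two {p : ℕ} [Fact p.Prime] (hp : p ≠ 2) : KloostermanBound p 0 2 := by
  have h1 : KloostermanBound p (4 * p + 1) 2 := by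
    intro F _ _ _ _ ψ a hψ hfrob ha hF
    have hlim : Filter.Tendsto (fun n : ℕ => (2 + 2 * p / 4 ^ n : ℝ) * √(Fintype.card F))
        Filter.atTop (nhds ((2 + 0) * √(Fintype.card F))) := by
      refine (Filter.Tendsto.const_add _ ?_).mul_const _
      exact tendsto_const_nhds.div_atTop (tendsto_pow_atTop_atTop_of_one_lt (by norm_num))
    rw [add_zero] at hlim
    exact ge_of_tendsto' hlim fun n =>
      kloostermanBound_add_div_pow hp n F ψ a hψ hfrob ha hF
  have hp3 : 3 ≤ p := by
    have := (Fact.out : p.Prime).two_le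
    omega
  have h2 : ∀ N N', N ≤ N' ^ 2 → KloostermanBound p N 2 → KloostermanBound p N' 2 := by
    intro N N' hN h
    have := KloostermanBound.descend (δ := 0) hp le_rfl hN (by simpa using h)
    simpa using this
  have h3 : KloostermanBound p p 2 := by
    refine h2 (p ^ 2) p le_rfl (h2 (4 * p + 1) (p ^ 2) ?_ h1)
    have : 3 * 3 ≤ p * p := Nat.mul_le_mul hp3 hp3
    nlinarith
  intro F _ _ _ _ ψ a hψ hfrob ha _
  refine h3 F ψ a hψ hfrob ha ?_
  obtain ⟨r, -, hr⟩ := FiniteField.card F p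
  rw [hr]
  exact Nat.le_self_pow r.ne_zero p

theorem norm_kloostermanSum_le_card_units {R : Type*} [CommRing R] [Fintype R] [DecidableEq R]
    (ψ : AddChar R ℂ) (a : R) : ‖kloostermanSum ψ a‖ ≤ Fintype.card Rˣ := by
  refine (norm_sum_le _ _).trans ?_
  simp [AddChar.norm_apply]

/-- Weil's bound for Kloosterman sums to a prime modulus. -/
theorem norm_kloostermanSum_zmod_prime_le {p : ℕ} [Fact p.Prime] {ψ : AddChar (ZMod p) ℂ}
    (hψ : ψ ≠ 0) (a : ZMod p) : ‖kloostermanSum ψ a‖ ≤ 2 * √p := by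
  have h1 : (1 : ℝ) ≤ √p := by
    rw [Real.one_le_sqrt]
    exact_mod_cast (Fact.out : p.Prime).one_le
  by_cases hp : p = 2
  · subst hp
    refine (norm_kloostermanSum_le_card_units ψ a).trans ?_
    rw [ZMod.card_units]
    push_cast at h1 ⊢
    linarith
  by_cases ha : a = 0
  · have : kloostermanSum ψ a = -1 := by
      have h0 := AddChar.sum_eq_zero_iff_ne_zero.2 hψ
      rw [← Finset.add_sum_erase _ _ (Finset.mem_univ 0), AddChar.map_zero_eq_one] at h0
      rw [← add_eq_zero_iff_eq_neg', ← h0, kloostermanSum]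
      congr 1
      refine Finset.sum_bij (fun x _ => ((x⁻¹ : (ZMod p)ˣ) : ZMod p)) ?_ ?_ ?_ ?_
      · intro x _
        exact Finset.mem_erase.2 ⟨Units.ne_zero _, Finset.mem_univ _⟩
      · intro x _ y _ hxy
        exact inv_injective (Units.ext hxy)
      · intro y hy
        exact ⟨(Units.mk0 y (Finset.mem_erase.1 hy).1)⁻¹, Finset.mem_univ _, by simp⟩
      · intro x _
        rw [ha, zero_mul, zero_add]
    rw [this, norm_neg, norm_one]
    linarith
  · have := kloostermanBound_two hp (ZMod p) ψ a hψ (fun x => by rw [ZMod.pow_card]) ha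
      (Nat.zero_le _)
    rwa [ZMod.card] at this

end PrimeModulus

section PrimePower

variable {R : Type*} [CommRing R] [Fintype R] {ψ : AddChar R ℂ}

theorem sum_quadratic_eq_zero {c β δ h : R} (hh : δ * h = 0) (hψ : ψ (β * h) ≠ 1) :
    ∑ r, ψ (c + β * r + δ * r ^ 2) = 0 := by
  have e1 : ∑ r, ψ (c + β * r + δ * r ^ 2) = ψ (β * h) * ∑ r, ψ (c + β * r + δ * r ^ 2) := by
    rw [Finset.mul_sum, ← Equiv.sum_comp (Equiv.addLeft h)]
    refine Finset.sum_congr rfl fun r _ => ?_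
    rw [← AddChar.map_add_eq_mul, Equiv.coe_addLeft]
    congr 1
    linear_combination (2 * r + h) * hh
  have e2 : (ψ (β * h) - 1) * ∑ r, ψ (c + β * r + δ * r ^ 2) = 0 := by
    rw [sub_mul, one_mul, ← e1, sub_self]
  exact (mul_eq_zero.1 e2).resolve_left (sub_ne_zero.2 hψ)

variable [DecidableEq R]

theorem norm_sum_quadratic_sq_le (hψ : ψ.IsPrimitive) (c β δ : R) :
    ‖∑ r, ψ (c + β * r + δ * r ^ 2)‖ ^ 2 ≤ Fintype.card R * #{h : R | 2 * δ * h = 0} := by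
  have key : (∑ r, ψ (c + β * r + δ * r ^ 2)) *
      (starRingEnd ℂ) (∑ r, ψ (c + β * r + δ * r ^ 2)) =
      ∑ h, if 2 * δ * h = 0 then ψ (β * h + δ * h ^ 2) * Fintype.card R else 0 := by
    rw [map_sum, Finset.sum_mul_sum, Finset.sum_comm]
    have e1 : ∀ s, ∑ r, ψ (c + β * r + δ * r ^ 2) * (starRingEnd ℂ) (ψ (c + β * s + δ * s ^ 2)) =
        ∑ h, ψ (β * h + δ * h ^ 2) * ψ (s * (2 * δ * h)) := by
      intro s
      rw [← Equiv.sum_comp (Equiv.addLeft s)]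
      refine Finset.sum_congr rfl fun h _ => ?_
      rw [← AddChar.map_neg_eq_conj, ← AddChar.map_add_eq_mul, ← AddChar.map_add_eq_mul,
        Equiv.coe_addLeft]
      congr 1
      ring
    rw [Finset.sum_congr rfl fun s _ => e1 s, Finset.sum_comm]
    refine Finset.sum_congr rfl fun h _ => ?_
    rw [← Finset.mul_sum, AddChar.sum_mulShift _ hψ, Nat.cast_ite, mul_ite, Nat.cast_zero,
      mul_zero]
  rw [Complex.mul_conj, Complex.normSq_eq_norm_sq] at key
  have h2 := congrArg norm key
  rw [Complex.norm_real, Real.norm_of_nonneg (by positivity)] at h2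
  rw [h2]
  refine (norm_sum_le _ _).trans ?_
  rw [Finset.card_filter, Nat.cast_sum, Finset.mul_sum]
  refine Finset.sum_le_sum fun h _ => ?_
  split_ifs <;> simp [AddChar.norm_apply]

theorem card_mul_kloostermanSum_eq {ϖ : R} (hϖ : ϖ ^ 3 = 0) (a : R) :
    Fintype.card R * kloostermanSum ψ a = ∑ x : Rˣ, ∑ r : R,
      ψ (a * x + ((x⁻¹ : Rˣ) : R) + ϖ * (a * x - ((x⁻¹ : Rˣ) : R)) * r +
        ((x⁻¹ : Rˣ) : R) * ϖ ^ 2 * r ^ 2) := by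
  rw [Finset.sum_comm]
  have e1 : ∀ r : R, ∑ x : Rˣ, ψ (a * x + ((x⁻¹ : Rˣ) : R) +
      ϖ * (a * x - ((x⁻¹ : Rˣ) : R)) * r + ((x⁻¹ : Rˣ) : R) * ϖ ^ 2 * r ^ 2) =
      kloostermanSum ψ a := by
    intro r
    let u : Rˣ := ⟨1 + ϖ * r, 1 - ϖ * r + ϖ ^ 2 * r ^ 2, by linear_combination r ^ 3 * hϖ,
      by linear_combination r ^ 3 * hϖ⟩
    rw [kloostermanSum, ← Equiv.sum_comp (Equiv.mulRight u)
      (fun x : Rˣ => ψ (a * x + ((x⁻¹ : Rˣ) : R)))]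
    refine Finset.sum_congr rfl fun x _ => ?_
    have hu : ((u⁻¹ : Rˣ) : R) = 1 - ϖ * r + ϖ ^ 2 * r ^ 2 := rfl
    rw [Equiv.coe_mulRight, mul_inv_rev, Units.val_mul, Units.val_mul, hu]
    congr 1
    simp only [u]
    ring
  rw [Finset.sum_congr rfl fun r _ => e1 r, Finset.sum_const, nsmul_eq_mul, Finset.card_univ]

theorem norm_kloostermanSum_le_of_pow_three_eq_zero (hψ : ψ.IsPrimitive) {ϖ σ : R}
    (hϖ : ϖ ^ 3 = 0) (hσ : ϖ ^ 2 * σ = 0) (a : R) :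
    Fintype.card R * ‖kloostermanSum ψ a‖ ≤
      #{x : Rˣ | ϖ * σ * (a * x ^ 2 - 1) = 0} *
        √(Fintype.card R * #{h : R | 2 * ϖ ^ 2 * h = 0}) := by
  have h1 := congrArg norm (card_mul_kloostermanSum_eq (ψ := ψ) hϖ a)
  rw [norm_mul, Complex.norm_natCast] at h1
  rw [h1, Finset.card_filter, Nat.cast_sum, Finset.sum_mul]
  refine (norm_sum_le _ _).trans (Finset.sum_le_sum fun x _ => ?_)
  split_ifs with hx
  · rw [Nat.cast_one, one_mul]
    refine Real.le_sqrt_of_sq_le ((norm_sum_quadratic_sq_le hψ _ _ _).trans_eq ?_)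
    congr 3
    ext h
    rw [Finset.mem_filter, Finset.mem_filter, show 2 * (((x⁻¹ : Rˣ) : R) * ϖ ^ 2) * h =
      ((x⁻¹ : Rˣ) : R) * (2 * ϖ ^ 2 * h) by ring, Units.mul_right_eq_zero]
  · have hb : ϖ * σ * (a * x - ((x⁻¹ : Rˣ) : R)) ≠ 0 := by
      contrapose hx
      linear_combination (x : R) * hx + ϖ * σ * x.mul_inv
    obtain ⟨s, hs⟩ := AddChar.ne_one_iff.1 (hψ hb)
    rw [AddChar.mulShift_apply] at hs
    rw [sum_quadratic_eq_zero (h := σ * s)]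
    · simp
    · linear_combination ((x⁻¹ : Rˣ) : R) * s * hσ
    · convert hs using 2
      ring

theorem pow_dvd_two_mul_or_of_pow_dvd_mul {p : ℕ} (hp : p.Prime) {i : ℕ} {u v w : ℤ}
    (hw : ¬ (p : ℤ) ∣ w) (huv : u + v = 2 * w) (h : (p : ℤ) ^ i ∣ u * v) :
    (p : ℤ) ^ i ∣ 2 * u ∨ (p : ℤ) ^ i ∣ 2 * v := by
  have hp' : Prime (p : ℤ) := Nat.prime_iff_prime_int.1 hp
  by_cases hu : (p : ℤ) ∣ u
  · by_cases hv : (p : ℤ) ∣ v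
    · have h2 : (p : ℤ) ∣ 2 := (hp'.dvd_or_dvd (huv ▸ dvd_add hu hv)).resolve_right hw
      have h2' : p = 2 := (Nat.prime_dvd_prime_iff_eq hp Nat.prime_two).1 (by exact_mod_cast h2)
      subst h2'
      obtain ⟨u, rfl⟩ := hu
      obtain ⟨v, rfl⟩ := hv
      push_cast at *
      by_cases hu : (2 : ℤ) ∣ u
      · have hv : ¬ (2 : ℤ) ∣ v := by omega
        left
        refine hp'.pow_dvd_of_dvd_mul_right i hv ?_
        rwa [show 2 * (2 * u) * v = 2 * u * (2 * v) by ring]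
      · right
        refine hp'.pow_dvd_of_dvd_mul_left i hu ?_
        rwa [show u * (2 * (2 * v)) = 2 * u * (2 * v) by ring]
    · exact Or.inl ((hp'.pow_dvd_of_dvd_mul_right i hv h).mul_left 2)
  · exact Or.inr ((hp'.pow_dvd_of_dvd_mul_left i hu h).mul_left 2)

theorem card_filter_natCast_mul_eq_zero_le {m c : ℕ} [NeZero m] (hc : 0 < c) :
    #{h : ZMod m | (c : ZMod m) * h = 0} ≤ c := by
  simpa only [nsmul_eq_mul] using IsAddCyclic.card_nsmul_eq_zero_le (α := ZMod m) hc

theorem ZMod.natCast_pow_mul_intCast_eq_zero_iff {p i j m : ℕ} (hp : p ≠ 0) (hm : m = p ^ (i + j))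
    (u : ℤ) : (p : ZMod m) ^ j * (u : ZMod m) = 0 ↔ (p : ℤ) ^ i ∣ u := by
  have : (p : ZMod m) ^ j * (u : ZMod m) = (((p : ℤ) ^ j * u : ℤ) : ZMod m) := by push_cast; rfl
  rw [this, ZMod.intCast_zmod_eq_zero_iff_dvd, hm, Nat.cast_pow, pow_add, mul_comm,
    mul_dvd_mul_iff_left (by positivity)]

theorem card_filter_pow_mul_sq_sub_one_le {p i j m : ℕ} (hp : p.Prime) [NeZero m]
    (hm : m = p ^ (i + j)) (a : ZMod m) :
    #{x : (ZMod m)ˣ | (p : ZMod m) ^ j * (a * x ^ 2 - 1) = 0} ≤ 4 * p ^ j := by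
  set s : Finset (ZMod m)ˣ := {x | (p : ZMod m) ^ j * (a * x ^ 2 - 1) = 0} with hs
  obtain hs0 | ⟨x₀, hx₀⟩ := s.eq_empty_or_nonempty
  · simp [hs0]
  rcases Nat.eq_zero_or_pos i with hi | hi
  · refine (Finset.card_le_univ _).trans ?_
    rw [ZMod.card_units_eq_totient]
    refine (Nat.totient_le _).trans ?_
    rw [hm, hi, zero_add]
    omega
  let N : Finset (ZMod m) := {h | ((2 * p ^ j : ℕ) : ZMod m) * h = 0}
  have hN : #N ≤ 2 * p ^ j := card_filter_natCast_mul_eq_zero_le (by have := hp.pos; positivity)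
  have hsub : s.image (fun x : (ZMod m)ˣ => (x : ZMod m)) ⊆
      N.image (fun h => h + x₀) ∪ N.image (fun h => h - x₀) := by
    intro y hy
    obtain ⟨x, hx, rfl⟩ := Finset.mem_image.1 hy
    rw [hs, Finset.mem_filter] at hx hx₀
    have h1 : (p : ZMod m) ^ j * ((x - x₀) * (x + x₀)) = 0 := by
      linear_combination (x : ZMod m) ^ 2 * hx₀.2 * (-1) + (x₀ : ZMod m) ^ 2 * hx.2
    obtain ⟨w, hw⟩ := ZMod.intCast_surjective (x : ZMod m)
    obtain ⟨w₀, hw₀⟩ := ZMod.intCast_surjective (x₀ : ZMod m)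
    have hcast : ∀ u : ℤ, (p : ZMod m) ^ j * (u : ZMod m) = 0 ↔ (p : ℤ) ^ i ∣ u := fun u =>
      ZMod.natCast_pow_mul_intCast_eq_zero_iff hp.ne_zero hm u
    rw [← hw, ← hw₀, ← Int.cast_sub, ← Int.cast_add, ← Int.cast_mul, hcast] at h1
    have hwp : ¬ (p : ℤ) ∣ w := by
      intro hdvd
      have h3 : IsCoprime w (m : ℤ) := by
        rw [isCoprime_comm, ← ZMod.coe_int_isUnit_iff_isCoprime, hw]
        exact x.isUnit
      have h4 : (p : ℤ) ∣ (m : ℤ) := by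
        exact_mod_cast hm ▸ dvd_pow_self p (by omega)
      have := h3.isUnit_of_dvd' hdvd h4
      exact (Nat.prime_iff_prime_int.1 hp).not_isUnit this
    have h5 := pow_dvd_two_mul_or_of_pow_dvd_mul hp hwp (by ring) h1
    rw [← hcast, ← hcast] at h5
    rw [Finset.mem_union, Finset.mem_image, Finset.mem_image]
    refine h5.imp (fun h => ⟨x - x₀, ?_, by ring⟩) fun h => ⟨x + x₀, ?_, by ring⟩
    · rw [Finset.mem_filter, ← hw, ← hw₀]
      refine ⟨Finset.mem_univ _, ?_⟩
      push_cast at h ⊢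
      linear_combination h
    · rw [Finset.mem_filter, ← hw, ← hw₀]
      refine ⟨Finset.mem_univ _, ?_⟩
      push_cast at h ⊢
      linear_combination h
  rw [← Finset.card_image_of_injective s (f := fun x : (ZMod m)ˣ => (x : ZMod m))
    Units.val_injective]
  refine (Finset.card_le_card hsub).trans ((Finset.card_union_le _ _).trans ?_)
  have h1 := (Finset.card_image_le (s := N) (f := fun h => h + (x₀ : ZMod m)))
  have h2 := (Finset.card_image_le (s := N) (f := fun h => h - (x₀ : ZMod m)))
  omega

theorem norm_kloostermanSum_zmod_prime_pow_le {p n m : ℕ} (hp : p.Prime) (hn : n ≠ 0) [NeZero m]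
    (hm : m = p ^ n) {ψ : AddChar (ZMod m) ℂ} (hψ : ψ.IsPrimitive) (a : ZMod m) :
    ‖kloostermanSum ψ a‖ ≤ 6 * √m := by
  have _ : Fact p.Prime := ⟨hp⟩
  rcases eq_or_ne n 1 with rfl | hn1
  · rw [pow_one] at hm
    subst hm
    have hψ0 : ψ ≠ 0 := by
      have := hψ one_ne_zero
      rwa [AddChar.mulShift_one] at this
    refine (norm_kloostermanSum_zmod_prime_le hψ0 a).trans ?_
    gcongr
    norm_num
  obtain ⟨i, e, rfl, he⟩ : ∃ i e, n = i + (i + e) ∧ e ≤ 1 := ⟨n / 2, n % 2, by omega, by omega⟩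
  have hm0 : (p : ZMod m) ^ (i + (i + e)) = 0 := by
    rw [← Nat.cast_pow, ← hm, ZMod.natCast_self]
  have key := norm_kloostermanSum_le_of_pow_three_eq_zero hψ (ϖ := (p : ZMod m) ^ i)
    (σ := (p : ZMod m) ^ e) (by
      obtain ⟨t, ht⟩ : ∃ t, i * 3 = i + (i + e) + t := ⟨i - e, by omega⟩
      rw [← pow_mul, ht, pow_add, hm0, zero_mul])
    (by rw [← hm0]; ring) a
  have hA := card_filter_pow_mul_sq_sub_one_le hp hm a
  have hB : #{h : ZMod m | 2 * ((p : ZMod m) ^ i) ^ 2 * h = 0} ≤ 2 * (p ^ i) ^ 2 := by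
    have := card_filter_natCast_mul_eq_zero_le (m := m) (c := 2 * (p ^ i) ^ 2)
      (by have := hp.pos; positivity)
    simpa using this
  rw [ZMod.card] at key
  rw [← pow_add] at key
  have hm1 : (0 : ℝ) < m := by exact_mod_cast NeZero.pos m
  refine le_of_mul_le_mul_left (key.trans ?_) hm1
  calc _ ≤ ((4 * p ^ (i + e) : ℕ) : ℝ) * √(m * (2 * (p ^ i) ^ 2 : ℕ)) := by
        gcongr
    _ = m * (4 * √2 * √m) := by
        have h3 : √((m : ℝ) * (2 * (p ^ i) ^ 2 : ℕ)) = √m * (√2 * p ^ i) := by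
          push_cast
          rw [Real.sqrt_mul hm1.le, Real.sqrt_mul zero_le_two, Real.sqrt_sq (by positivity)]
        have h4 : (m : ℝ) = p ^ i * p ^ (i + e) := by rw [hm]; push_cast; ring
        rw [h3]
        nth_rewrite 2 [h4]
        push_cast
        ring
    _ ≤ m * (6 * √m) := by
        have : √2 ≤ 1.5 := by
          rw [Real.sqrt_le_left (by norm_num)]
          norm_num
        gcongr
        linarith

end PrimePower

section Composite

theorem kloostermanSum_eq_mul {R R₁ R₂ : Type*} [CommRing R] [CommRing R₁] [CommRing R₂]
    [Fintype R] [Fintype R₁] [Fintype R₂] [DecidableEq R] [DecidableEq R₁] [DecidableEq R₂]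
    (e : R ≃+* R₁ × R₂) {ψ : AddChar R ℂ} (hψ : ψ.IsPrimitive) (a : R) :
    ∃ (ψ₁ : AddChar R₁ ℂ) (ψ₂ : AddChar R₂ ℂ), ψ₁.IsPrimitive ∧ ψ₂.IsPrimitive ∧
      kloostermanSum ψ a = kloostermanSum ψ₁ (e a).1 * kloostermanSum ψ₂ (e a).2 := by
  let f₁ : R₁ →+ R := (e.symm : R₁ × R₂ →+ R).comp (AddMonoidHom.inl R₁ R₂)
  let f₂ : R₂ →+ R := (e.symm : R₁ × R₂ →+ R).comp (AddMonoidHom.inr R₁ R₂)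
  have hf₁ : ∀ x, f₁ x = e.symm (x, 0) := fun _ => rfl
  have hf₂ : ∀ x, f₂ x = e.symm (0, x) := fun _ => rfl
  refine ⟨ψ.compAddMonoidHom f₁, ψ.compAddMonoidHom f₂, ?_, ?_, ?_⟩
  · intro b hb
    obtain ⟨z, hz⟩ := AddChar.ne_one_iff.1 (hψ (a := e.symm (b, 0)) (by simpa using hb))
    refine AddChar.ne_one_iff.2 ⟨(e z).1, ?_⟩
    convert hz using 2
    change ψ (e.symm (b * (e z).1, 0)) = ψ (e.symm (b, 0) * z)
    congr 1
    apply e.injective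
    ext <;> simp
  · intro b hb
    obtain ⟨z, hz⟩ := AddChar.ne_one_iff.1 (hψ (a := e.symm (0, b)) (by simpa using hb))
    refine AddChar.ne_one_iff.2 ⟨(e z).2, ?_⟩
    convert hz using 2
    change ψ (e.symm (0, b * (e z).2)) = ψ (e.symm (0, b) * z)
    congr 1
    apply e.injective
    ext <;> simp
  · let E : Rˣ ≃ R₁ˣ × R₂ˣ := ((Units.mapEquiv e.toMulEquiv).trans MulEquiv.prodUnits).toEquiv
    rw [kloostermanSum, kloostermanSum, kloostermanSum, Finset.sum_mul_sum,
      ← Fintype.sum_prod_type', ← Equiv.sum_comp E]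
    refine Finset.sum_congr rfl fun x _ => ?_
    rw [AddChar.compAddMonoidHom_apply, AddChar.compAddMonoidHom_apply, ← AddChar.map_add_eq_mul,
      hf₁, hf₂]
    congr 1
    apply e.injective
    have h1 : ((E x).1 : R₁) = (e x).1 := rfl
    have h2 : ((E x).2 : R₂) = (e x).2 := rfl
    have h3 : (((E x).1⁻¹ : R₁ˣ) : R₁) = (e (x⁻¹ : Rˣ)).1 := rfl
    have h4 : (((E x).2⁻¹ : R₂ˣ) : R₂) = (e (x⁻¹ : Rˣ)).2 := rfl
    rw [h1, h2, h3, h4]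
    ext <;> simp

theorem norm_kloostermanSum_zmod_le {m : ℕ} [NeZero m] {ψ : AddChar (ZMod m) ℂ}
    (hψ : ψ.IsPrimitive) (a : ZMod m) : ‖kloostermanSum ψ a‖ ≤ 6 ^ #m.primeFactors * √m := by
  suffices h : ∀ (m : ℕ) [NeZero m] (ψ : AddChar (ZMod m) ℂ), ψ.IsPrimitive → ∀ a : ZMod m,
      ‖kloostermanSum ψ a‖ ≤ 6 ^ #m.primeFactors * √m from h m ψ hψ a
  clear! m
  intro m
  induction m using Nat.recOnPosPrimePosCoprime with
  | zero =>
    intro h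
    exact absurd rfl h.out
  | one =>
    intro _ ψ _ a
    refine (norm_kloostermanSum_le_card_units ψ a).trans ?_
    rw [ZMod.card_units_eq_totient]
    simp
  | prime_pow p n hp hn =>
    intro _ ψ hψ a
    rw [Nat.primeFactors_prime_pow hn.ne' hp, Finset.card_singleton, pow_one]
    exact norm_kloostermanSum_zmod_prime_pow_le hp hn.ne' rfl hψ a
  | coprime m₁ m₂ h1 h2 hcop ih₁ ih₂ =>
    intro _ ψ hψ a
    have _ : NeZero m₁ := ⟨by omega⟩
    have _ : NeZero m₂ := ⟨by omega⟩
    obtain ⟨ψ₁, ψ₂, hψ₁, hψ₂, hS⟩ := kloostermanSum_eq_mul (ZMod.chineseRemainder hcop) hψ a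
    rw [hS, norm_mul, hcop.primeFactors_mul,
      Finset.card_union_of_disjoint hcop.disjoint_primeFactors,
      pow_add, Nat.cast_mul, Real.sqrt_mul m₁.cast_nonneg, mul_mul_mul_comm]
    exact mul_le_mul (ih₁ ψ₁ hψ₁ _) (ih₂ ψ₂ hψ₂ _) (norm_nonneg _) (by positivity)

theorem exists_pow_card_primeFactors_le {b : ℝ} (hb : 1 ≤ b) {ε : ℝ} (hε : 0 < ε) :
    ∃ C : ℝ, 0 < C ∧ ∀ m : ℕ, m ≠ 0 → b ^ #m.primeFactors ≤ C * (m : ℝ) ^ ε := by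
  obtain ⟨P, hP⟩ := Filter.eventually_atTop.1
    (((tendsto_rpow_atTop hε).comp tendsto_natCast_atTop_atTop).eventually_ge_atTop b)
  refine ⟨b ^ P, by positivity, fun m hm => ?_⟩
  rw [← Finset.card_filter_add_card_filter_not (s := m.primeFactors) (· < P), pow_add]
  refine mul_le_mul ?_ ?_ (by positivity) (by positivity)
  · refine pow_le_pow_right₀ hb ?_
    calc _ ≤ #(Finset.range P) := Finset.card_le_card fun p hp =>
          Finset.mem_range.2 (Finset.mem_filter.1 hp).2
      _ = P := Finset.card_range P
  · rw [← Finset.prod_const]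
    calc _ ≤ ∏ p ∈ m.primeFactors with ¬ p < P, (p : ℝ) ^ ε := by
          refine Finset.prod_le_prod (fun _ _ => by positivity) fun p hp => ?_
          exact hP p (not_lt.1 (Finset.mem_filter.1 hp).2)
      _ = ((∏ p ∈ m.primeFactors with ¬ p < P, p : ℕ) : ℝ) ^ ε := by
          rw [Nat.cast_prod, Real.finsetProd_rpow _ _ fun _ _ => Nat.cast_nonneg _]
      _ ≤ (m : ℝ) ^ ε := by
          refine Real.rpow_le_rpow (Nat.cast_nonneg _) ?_ hε.le
          rw [Nat.cast_le]
          refine Nat.le_of_dvd (Nat.pos_of_ne_zero hm) ?_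
          exact (Finset.prod_dvd_prod_of_subset _ _ _ (Finset.filter_subset _ _)).trans
            (Nat.prod_primeFactors_dvd m)

end Composite

section WeilBound

theorem Kl_eq_kloostermanSum (m : ℕ) [NeZero m] (a : ℤ) :
    Kl m a = (1 / √m : ℝ) * kloostermanSum (ZMod.stdAddChar (N := m)) (a : ZMod m) := by
  rw [Kl, kloostermanSum, Complex.ofReal_div, Complex.ofReal_one]
  congr 1
  refine Finset.sum_bij (fun x hx => ZMod.unitOfCoprime x (Finset.mem_filter.1 hx).2) ?_ ?_ ?_ ?_
  · exact fun _ _ => Finset.mem_univ _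
  · intro x hx y hy hxy
    have h := congrArg Units.val hxy
    rw [ZMod.coe_unitOfCoprime, ZMod.coe_unitOfCoprime, ZMod.natCast_eq_natCast_iff',
      Nat.mod_eq_of_lt (Finset.mem_range.1 (Finset.mem_filter.1 hx).1),
      Nat.mod_eq_of_lt (Finset.mem_range.1 (Finset.mem_filter.1 hy).1)] at h
    exact h
  · intro u _
    refine ⟨(u : ZMod m).val, Finset.mem_filter.2 ⟨Finset.mem_range.2 (ZMod.val_lt _),
      ZMod.val_coe_unit_coprime u⟩, Units.ext ?_⟩
    rw [ZMod.coe_unitOfCoprime, ZMod.natCast_zmod_val]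
  · intro x hx
    rw [← mul_div_assoc, ← ZMod.stdAddChar_coe]
    congr 1
    rw [← ZMod.inv_coe_unit, ZMod.coe_unitOfCoprime]
    push_cast
    rw [ZMod.natCast_zmod_val]

theorem exists_norm_Kl_le {ε : ℝ} (hε : 0 < ε) :
    ∃ C : ℝ, 0 < C ∧ ∀ (m : ℕ) (a : ℤ), m ≠ 0 → ‖Kl m a‖ ≤ C * (m : ℝ) ^ ε := by
  obtain ⟨C, hC, h⟩ := exists_pow_card_primeFactors_le (b := 6) (by norm_num) hε
  refine ⟨C, hC, fun m a hm => le_trans ?_ (h m hm)⟩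
  have _ : NeZero m := ⟨hm⟩
  have hm' : 0 < √(m : ℝ) := Real.sqrt_pos.2 (Nat.cast_pos.2 (Nat.pos_of_ne_zero hm))
  rw [Kl_eq_kloostermanSum, norm_mul, Complex.norm_real, Real.norm_of_nonneg (by positivity),
    one_div, inv_mul_le_iff₀ hm', mul_comm]
  exact norm_kloostermanSum_zmod_le (ZMod.isPrimitive_stdAddChar m) _

end WeilBound

section PowerFree

open ArithmeticFunction in
/-- Inclusion-exclusion for the indicator of `k`-th-power-free integers. -/
theorem kappa_eq_sum_moebius {k m M : ℕ} (hk : k ≠ 0) (hm : m ≠ 0) (hM : m ≤ M) :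
    kappa k m = ∑ d ∈ Finset.Icc 1 M with d ^ k ∣ m, (moebius d : ℝ) := by
  have h1 : ((Finset.Icc 1 M).filter fun d => d ^ k ∣ m) = (Nat.floorRoot k m).divisors := by
    ext d
    rw [Finset.mem_filter, Finset.mem_Icc, Nat.mem_divisors, Nat.pow_dvd_iff_dvd_floorRoot]
    have h0 : Nat.floorRoot k m ≠ 0 := Nat.floorRoot_ne_zero.2 ⟨hk, hm⟩
    refine ⟨fun h => ⟨h.2, h0⟩,
      fun h => ⟨⟨Nat.pos_of_dvd_of_pos h.1 (Nat.pos_of_ne_zero h0), ?_⟩, h.1⟩⟩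
    refine le_trans ?_ hM
    exact Nat.le_of_dvd (Nat.pos_of_ne_zero hm)
      ((dvd_pow_self d hk).trans (Nat.pow_dvd_iff_dvd_floorRoot.2 h.1))
  have h2 : (∑ d ∈ (Nat.floorRoot k m).divisors, (moebius d : ℝ)) =
      if Nat.floorRoot k m = 1 then 1 else 0 := by
    have := congrArg (fun f => f (Nat.floorRoot k m)) (coe_moebius_mul_coe_zeta (R := ℝ))
    simp only [coe_mul_zeta_apply, one_apply] at this
    simpa using this
  rw [h1, h2, kappa]
  congr 1
  simp only [Nat.pow_dvd_iff_dvd_floorRoot, Nat.eq_one_iff_not_exists_prime_dvd]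

end PowerFree

section Sieve

theorem sum_Kl_mul_kappa_eq (a : ℤ) {k : ℕ} (hk : k ≠ 0) (M : ℕ) :
    ∑ m ∈ Finset.Icc 1 M, Kl m a * ((kappa k m : ℝ) : ℂ) =
      ∑ d ∈ Finset.Icc 1 M, (ArithmeticFunction.moebius d : ℂ) *
        ∑ m ∈ Finset.Icc 1 M with d ^ k ∣ m, Kl m a := by
  have h : ∀ m ∈ Finset.Icc 1 M, Kl m a * ((kappa k m : ℝ) : ℂ) =
      ∑ d ∈ Finset.Icc 1 M,
        if d ^ k ∣ m then (ArithmeticFunction.moebius d : ℂ) * Kl m a else 0 := by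
    intro m hm
    rw [Finset.mem_Icc] at hm
    rw [kappa_eq_sum_moebius hk (by omega) hm.2, Complex.ofReal_sum, Finset.mul_sum,
      Finset.sum_filter]
    refine Finset.sum_congr rfl fun d _ => ?_
    split_ifs
    · rw [mul_comm, Complex.ofReal_intCast]
    · rfl
  rw [Finset.sum_congr rfl h, Finset.sum_comm]
  refine Finset.sum_congr rfl fun d _ => ?_
  rw [Finset.mul_sum, Finset.sum_filter]

theorem norm_sum_dvd_le {f : ℕ → ℂ} {B : ℝ} {M q : ℕ} (hB : 0 ≤ B)
    (hf : ∀ m ∈ Finset.Icc 1 M, ‖f m‖ ≤ B) :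
    ‖∑ m ∈ Finset.Icc 1 M with q ∣ m, f m‖ ≤ B * (M / q) := by
  have hcard : #{m ∈ Finset.Icc 1 M | q ∣ m} = M / q := Nat.Ioc_filter_dvd_card_eq_div M q
  calc _ ≤ ∑ m ∈ Finset.Icc 1 M with q ∣ m, B := norm_sum_le_of_le _ fun m hm =>
        hf m (Finset.mem_filter.1 hm).1
    _ = B * (M / q : ℕ) := by rw [Finset.sum_const, hcard, nsmul_eq_mul, mul_comm]
    _ ≤ B * (M / q) := by gcongr; exact Nat.cast_div_le

theorem sum_one_div_le {ε : ℝ} (hε : 0 < ε) {M : ℕ} (hM : 1 ≤ M) :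
    ∑ d ∈ Finset.Icc 1 M, (1 / d : ℝ) ≤ (1 + 1 / ε) * (M : ℝ) ^ ε := by
  have h1 : ∑ d ∈ Finset.Icc 1 M, (1 / d : ℝ) ≤ 1 + Real.log M := by
    have := harmonic_le_one_add_log M
    rw [harmonic_eq_sum_Icc] at this
    push_cast at this
    simpa only [one_div] using this
  have hM' : (1 : ℝ) ≤ M := by exact_mod_cast hM
  have h2 := Real.log_le_rpow_div (Nat.cast_nonneg M) hε
  have h3 := Real.one_le_rpow hM' hε.le
  calc _ ≤ 1 + Real.log M := h1
    _ ≤ (M : ℝ) ^ ε + (M : ℝ) ^ ε / ε := add_le_add h3 h2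
    _ = _ := by ring

theorem sqrt_mul_div_rpow_le {M d k γ : ℝ} (hM : 1 ≤ M) (hd : 1 ≤ d) (hk : 1 ≤ k) (hγ : 0 < γ)
    (h : d ≤ M ^ (1 / (2 * k))) : M ^ (1 / 2 : ℝ) * (M / (d ^ k) ^ 2) ^ γ ≤
      (M ^ (1 / 2 + γ) + M ^ (1 / 2 + 1 / (2 * k))) / d := by
  have hM0 : 0 < M := by linarith
  have hd0 : 0 < d := by linarith
  have h1 : (M / (d ^ k) ^ 2) ^ γ = M ^ γ / d ^ (2 * k * γ) := by
    rw [Real.div_rpow hM0.le (by positivity), ← Real.rpow_mul_natCast hd0.le,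
      ← Real.rpow_mul hd0.le]
    congr 2
    push_cast
    ring
  rcases le_total (2 * k * γ) 1 with h2 | h2
  · have h3 : (M / (d ^ k) ^ 2) ^ γ ≤ M ^ (1 / (2 * k)) / d := by
      have h4 : M ^ γ = (M ^ (1 / (2 * k))) ^ (2 * k * γ) := by
        rw [← Real.rpow_mul hM0.le]
        congr 1
        field_simp
      rw [h1, h4, ← Real.div_rpow (by positivity) hd0.le]
      exact Real.rpow_le_self_of_one_le ((one_le_div hd0).2 h) h2
    calc _ ≤ M ^ (1 / 2 : ℝ) * (M ^ (1 / (2 * k)) / d) := by gcongr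
      _ = M ^ (1 / 2 + 1 / (2 * k)) / d := by rw [Real.rpow_add hM0]; ring
      _ ≤ _ := by
        gcongr
        exact le_add_of_nonneg_left (by positivity)
  · have h3 : d ≤ d ^ (2 * k * γ) := Real.self_le_rpow_of_one_le hd h2
    calc _ ≤ M ^ (1 / 2 : ℝ) * (M ^ γ / d) := by rw [h1]; gcongr
      _ = M ^ (1 / 2 + γ) / d := by rw [Real.rpow_add hM0]; ring
      _ ≤ _ := by
        gcongr
        exact le_add_of_nonneg_right (by positivity)

theorem div_rpow_le {M d k : ℝ} (hM : 1 ≤ M) (hk : 1 ≤ k) (h : M ^ (1 / (2 * k)) ≤ d) :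
    M / d ^ k ≤ M ^ (1 / 2 + 1 / (2 * k)) / d := by
  have hM0 : 0 < M := by linarith
  have hd0 : 0 < d := (Real.rpow_pos_of_pos hM0 _).trans_le h
  have h1 : (M ^ (1 / (2 * k)) / d) ^ k ≤ M ^ (1 / (2 * k)) / d :=
    Real.rpow_le_self_of_le_one (by positivity) ((div_le_one hd0).2 h) hk
  rw [Real.div_rpow (by positivity) hd0.le, ← Real.rpow_mul hM0.le,
    show 1 / (2 * k) * k = (1 / 2 : ℝ) by field_simp] at h1
  calc M / d ^ k = M ^ (1 / 2 : ℝ) * (M ^ (1 / 2 : ℝ) / d ^ k) := by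
        rw [← mul_div_assoc, ← Real.rpow_add hM0, add_halves, Real.rpow_one]
    _ ≤ M ^ (1 / 2 : ℝ) * (M ^ (1 / (2 * k)) / d) := by gcongr
    _ = _ := by rw [← mul_div_assoc, ← Real.rpow_add hM0]

end Sieve

/-- Assuming the Kloosterman average bound in progressions, the Kloosterman sums do not
correlate with the indicator of `k`-th-power-free numbers:
`∑_{m ≤ M} K_m(a) κ_k(m) ≪ M^(1/2 + γ + o(1)) + M^(1/2 + 1/(2k) + o(1))`. -/
theorem stmt_8 (a : ℤ) (k : ℕ) (hk : 2 ≤ k) (γ : ℝ) (hγ0 : 0 < γ) (hγ1 : γ ≤ 1 / 2)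
    (H : ∀ ε : ℝ, 0 < ε → ∀ α : ℝ, -(1 / 2) ≤ α → ∃ C : ℝ,
      ∀ q M : ℕ, 1 ≤ q → 1 ≤ M →
        ‖∑ m ∈ (Finset.Icc 1 M).filter (fun m => q ∣ m),
            (((m : ℝ) ^ α : ℝ) : ℂ) * Kl m a‖ ≤
          C * (M : ℝ) ^ (α + 1 / 2) * ((M : ℝ) / (q : ℝ) ^ 2) ^ γ * ((M : ℝ) * (q : ℝ)) ^ ε) :
    ∀ ε : ℝ, 0 < ε → ∃ C : ℝ, ∀ M : ℕ, 1 ≤ M →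
      ‖∑ m ∈ Finset.Icc 1 M, Kl m a * ((kappa k m : ℝ) : ℂ)‖ ≤
        C * ((M : ℝ) ^ ((1 : ℝ) / 2 + γ + ε) + (M : ℝ) ^ ((1 : ℝ) / 2 + 1 / (2 * (k : ℝ)) + ε)) := by
  intro ε hε
  obtain ⟨δ, hδ, rfl⟩ : ∃ δ, 0 < δ ∧ ε = 3 * δ := ⟨ε / 3, by positivity, by ring⟩
  obtain ⟨C₁, hC₁⟩ := H δ hδ 0 (by norm_num)
  obtain ⟨C₂, hC₂, hKl⟩ := exists_norm_Kl_le hδ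
  refine ⟨(|C₁| + C₂) * (1 + 1 / δ), fun M hM => ?_⟩
  have hM1 : (1 : ℝ) ≤ M := by exact_mod_cast hM
  have hM0 : (0 : ℝ) < M := by linarith
  have hk1 : (1 : ℝ) ≤ k := by exact_mod_cast (by omega : 1 ≤ k)
  set X : ℝ := (M : ℝ) ^ (1 / 2 + γ) + (M : ℝ) ^ (1 / 2 + 1 / (2 * (k : ℝ))) with hX
  have hM2 : (M : ℝ) ^ (2 * δ) = ((M : ℝ) * M) ^ δ := by
    rw [← sq, ← Real.rpow_natCast_mul hM0.le]
    norm_num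
  have hterm : ∀ d ∈ Finset.Icc 1 M, ‖∑ m ∈ Finset.Icc 1 M with d ^ k ∣ m, Kl m a‖ ≤
      (|C₁| + C₂) * (M : ℝ) ^ (2 * δ) * X * (1 / d) := by
    intro d hd
    have hd1 : 1 ≤ d := (Finset.mem_Icc.1 hd).1
    have hd1' : (1 : ℝ) ≤ d := by exact_mod_cast hd1
    have hd0 : (0 : ℝ) < d := by linarith
    rcases le_total (d : ℝ) ((M : ℝ) ^ (1 / (2 * (k : ℝ)))) with h | h
    · have h1 := hC₁ (d ^ k) M (Nat.one_le_pow _ _ hd1) hM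
      simp only [Real.rpow_zero, Complex.ofReal_one, one_mul, zero_add] at h1
      have hdk : ((d ^ k : ℕ) : ℝ) ≤ M := by
        rw [Nat.cast_pow, ← Real.rpow_natCast]
        calc (d : ℝ) ^ (k : ℝ) ≤ ((M : ℝ) ^ (1 / (2 * (k : ℝ)))) ^ (k : ℝ) := by gcongr
          _ = (M : ℝ) ^ (1 / 2 : ℝ) := by
            rw [← Real.rpow_mul hM0.le]
            congr 1
            field_simp
          _ ≤ M := Real.rpow_le_self_of_one_le hM1 (by norm_num)
      have h2 := sqrt_mul_div_rpow_le hM1 hd1' hk1 hγ0 h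
      rw [Real.rpow_natCast, ← Nat.cast_pow] at h2
      calc _ ≤ C₁ * (M : ℝ) ^ (1 / 2 : ℝ) * ((M : ℝ) / ((d ^ k : ℕ) : ℝ) ^ 2) ^ γ *
            ((M : ℝ) * ((d ^ k : ℕ) : ℝ)) ^ δ := h1
        _ = C₁ * ((M : ℝ) ^ (1 / 2 : ℝ) * ((M : ℝ) / ((d ^ k : ℕ) : ℝ) ^ 2) ^ γ) *
            ((M : ℝ) * ((d ^ k : ℕ) : ℝ)) ^ δ := by ring
        _ ≤ (|C₁| + C₂) * (X / d) * ((M : ℝ) * M) ^ δ := by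
          gcongr
          exact (le_abs_self _).trans (le_add_of_nonneg_right hC₂.le)
        _ = _ := by rw [hM2]; ring
    · have h1 := norm_sum_dvd_le (f := fun m => Kl m a) (B := C₂ * (M : ℝ) ^ δ) (M := M)
        (q := d ^ k) (by positivity) (by
          intro m hm
          rw [Finset.mem_Icc] at hm
          refine (hKl m a (by omega)).trans ?_
          gcongr
          exact hm.2)
      have h2 := div_rpow_le hM1 hk1 h
      rw [Real.rpow_natCast, ← Nat.cast_pow] at h2
      calc _ ≤ C₂ * (M : ℝ) ^ δ * (M / (d ^ k : ℕ)) := h1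
        _ ≤ (|C₁| + C₂) * (M : ℝ) ^ (2 * δ) * (X / d) := by
          have h3 : (M : ℝ) ^ (1 / 2 + 1 / (2 * (k : ℝ))) ≤ X :=
            le_add_of_nonneg_left (by positivity)
          have h4 : (M : ℝ) ^ δ ≤ (M : ℝ) ^ (2 * δ) :=
            Real.rpow_le_rpow_of_exponent_le hM1 (by linarith)
          have h5 : (M / (d ^ k : ℕ) : ℝ) ≤ X / d := h2.trans (by gcongr)
          have h6 : C₂ ≤ |C₁| + C₂ := le_add_of_nonneg_left (abs_nonneg _)
          exact mul_le_mul (mul_le_mul h6 h4 (by positivity) (by positivity)) h5 (by positivity)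
            (by positivity)
        _ = _ := by ring
  rw [sum_Kl_mul_kappa_eq a (by omega)]
  calc _ ≤ ∑ d ∈ Finset.Icc 1 M, (|C₁| + C₂) * (M : ℝ) ^ (2 * δ) * X * (1 / d) := by
        refine norm_sum_le_of_le _ fun d hd => ?_
        rw [norm_mul, Complex.norm_intCast]
        have hμ : |((ArithmeticFunction.moebius d : ℤ) : ℝ)| ≤ 1 := by
          exact_mod_cast ArithmeticFunction.abs_moebius_le_one
        exact (mul_le_of_le_one_left (norm_nonneg _) hμ).trans (hterm d hd)
    _ = (|C₁| + C₂) * (M : ℝ) ^ (2 * δ) * X * ∑ d ∈ Finset.Icc 1 M, (1 / d : ℝ) := by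
        rw [Finset.mul_sum]
    _ ≤ (|C₁| + C₂) * (M : ℝ) ^ (2 * δ) * X * ((1 + 1 / δ) * (M : ℝ) ^ δ) := by
        gcongr
        exact sum_one_div_le hδ hM
    _ = _ := by
        rw [Real.rpow_add hM0 _ (3 * δ), Real.rpow_add hM0 _ (3 * δ),
          show 3 * δ = 2 * δ + δ by ring, Real.rpow_add hM0 (2 * δ) δ, hX]
        ring
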